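/- arXiv:2508.13988 — 4 statements merged into one kernel-verified Lean document; each statement's English description precedes it below -/
import Mathlib

section
/- If an element p of a d-complete poset P is the minimal element of some d-interval, then p is the minimal element of a unique d-interval I, and any d-interval having p as a tail element contains I. -/
variable {P : Type*} [PartialOrder P]

/-- A subset `S` of a poset is convex if it contains every element lying
between two of its elements. -/
def IsConvexSet (S : Set P) : Prop :=
  ∀ a ∈ S, ∀ b ∈ S, ∀ x, a ≤ x → x ≤ b → x ∈ S

/-- `S` has the structure of (an order ideal of) `d_k(1)` with side elements `w`, `z`:
`w` and `z` are incomparable, every other element of `S` lies below both or above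
both of them, the elements below them (the tail) form a chain of `k - 2` elements,
and the elements above them (the neck) form a chain. -/
def DkStruct (k : ℕ) (S : Set P) (w z : P) : Prop :=
  3 ≤ k ∧ w ∈ S ∧ z ∈ S ∧ ¬ w ≤ z ∧ ¬ z ≤ w ∧
  (∀ x ∈ S, x = w ∨ x = z ∨ (x ≤ w ∧ x ≤ z) ∨ (w ≤ x ∧ z ≤ x)) ∧
  IsChain (· ≤ ·) {x ∈ S | x ≤ w ∧ x ≤ z} ∧
  IsChain (· ≤ ·) {x ∈ S | w ≤ x ∧ z ≤ x} ∧
  {x ∈ S | x ≤ w ∧ x ≤ z}.ncard = k - 2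

/-- The interval `[a, b]` is a `d_k`-interval (isomorphic to `d_k(1)`)
with side elements `w` and `z`. -/
def IsDkIntervalWith (k : ℕ) (a b w z : P) : Prop :=
  a ≤ b ∧ DkStruct k (Set.Icc a b) w z ∧
    {x ∈ Set.Icc a b | w ≤ x ∧ z ≤ x}.ncard = k - 2

/-- The interval `[a, b]` is a `d_k`-interval. -/
def IsDkInterval (k : ℕ) (a b : P) : Prop := ∃ w z, IsDkIntervalWith k a b w z

/-- The interval `[a, b]` is a `d`-interval. -/
def IsDInterval (a b : P) : Prop := ∃ k, IsDkInterval k a b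

/-- The interval `[a, b]` is a `d`-interval with side elements `w` and `z`. -/
def IsDIntervalWith (a b w z : P) : Prop := ∃ k, IsDkIntervalWith k a b w z

/-- `p` is a neck element of the `d`-interval `[a, b]`. -/
def IsNeckOf (p a b : P) : Prop :=
  ∃ k w z, IsDkIntervalWith k a b w z ∧ p ∈ Set.Icc a b ∧ w ≤ p ∧ z ≤ p

/-- `p` is a tail element of the `d`-interval `[a, b]`. -/
def IsTailOf (p a b : P) : Prop :=
  ∃ k w z, IsDkIntervalWith k a b w z ∧ p ∈ Set.Icc a b ∧ p ≤ w ∧ p ≤ z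

/-- `S` is a `d_k^-`-convex set: a convex subset isomorphic to `d_k(1)` minus
its maximum (so the neck has `k - 3` elements). -/
def IsDkMinusConvex (k : ℕ) (S : Set P) : Prop :=
  IsConvexSet S ∧ ∃ w z, DkStruct k S w z ∧
    {x ∈ S | w ≤ x ∧ z ≤ x}.ncard = k - 3

/-- Proctor's axioms for a d-complete poset:
(1) every `d_k^-`-convex set can be completed above to a `d_k`-interval;
(2) the maximum of any `d`-interval covers no element outside the interval;
(3) no two `d^-`-convex sets differ only in their minimal elements. -/
def IsDComplete (P : Type*) [PartialOrder P] : Prop :=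
  (∀ (k : ℕ) (S : Set P), IsDkMinusConvex k S →
      ∃ z, z ∉ S ∧ ∃ a, IsDkInterval k a z ∧ Set.Icc a z = insert z S) ∧
  (∀ a b : P, IsDInterval a b → ∀ x, x ⋖ b → x ∈ Set.Icc a b) ∧
  (∀ (k k' : ℕ) (S T : Set P), IsDkMinusConvex k S → IsDkMinusConvex k' T →
      ∀ s ∈ S, ∀ t ∈ T, (∀ x ∈ S, s ≤ x) → (∀ x ∈ T, t ≤ x) →
        S \ {s} = T \ {t} → S = T)

lemma dk_peel {P : Type*} [PartialOrder P] [Fintype P] {m : ℕ} (hm : 3 ≤ m) {a b w z : P}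
    (h : IsDkIntervalWith (m+1) a b w z) :
    ∃ a' b', a ⋖ a' ∧ b' ⋖ b ∧ IsDkIntervalWith m a' b' w z ∧
      (∀ x ∈ Set.Icc a b, x ≠ a → a' ≤ x) ∧ (∀ x ∈ Set.Icc a b, x ≠ b → x ≤ b') := by
  obtain ⟨hab, ⟨-, hw, hz, hwz, hzw, hall, hct, hcn, hnt⟩, hnn⟩ := h
  set T := {x ∈ Set.Icc a b | x ≤ w ∧ x ≤ z} with hT
  set N := {x ∈ Set.Icc a b | w ≤ x ∧ z ≤ x} with hN
  have haT : a ∈ T := ⟨⟨le_rfl, hab⟩, hw.1, hz.1⟩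
  have hbN : b ∈ N := ⟨⟨hab, le_rfl⟩, hw.2, hz.2⟩
  have hT1 : (T \ {a}).ncard = m - 2 := by
    rw [Set.ncard_diff_singleton_of_mem haT, hnt]; omega
  have hN1 : (N \ {b}).ncard = m - 2 := by
    rw [Set.ncard_diff_singleton_of_mem hbN, hnn]; omega
  have hTne : (T \ {a}).Nonempty := by
    apply Set.nonempty_of_ncard_ne_zero; omega
  have hNne : (N \ {b}).Nonempty := by
    apply Set.nonempty_of_ncard_ne_zero; omega
  obtain ⟨a', ha'⟩ := (Set.toFinite (T \ {a})).exists_minimal hTne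
  obtain ⟨b', hb'⟩ := (Set.toFinite (N \ {b})).exists_maximal hNne
  have ha'T := ha'.1
  have hb'N := hb'.1
  have lea : ∀ x ∈ T, x ≠ a → a' ≤ x := by
    intro x hx hxa
    by_cases e : a' = x
    · exact e.le
    rcases hct ha'T.1 hx e with h | h
    · exact h
    · exact ha'.2 ⟨hx, hxa⟩ h
  have leb : ∀ x ∈ N, x ≠ b → x ≤ b' := by
    intro x hx hxa
    by_cases e : x = b'
    · exact e.le
    rcases hcn hx hb'N.1 e with h | h
    · exact h
    · exact hb'.2 ⟨hx, hxa⟩ h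
  have ha'w : a' ≤ w := ha'T.1.2.1
  have ha'z : a' ≤ z := ha'T.1.2.2
  have hb'w : w ≤ b' := hb'N.1.2.1
  have hb'z : z ≤ b' := hb'N.1.2.2
  have haa' : a ≤ a' := ha'T.1.1.1
  have hb'b : b' ≤ b := hb'N.1.1.2
  have hne1 : a' ≠ a := ha'T.2
  have hne2 : b' ≠ b := hb'N.2
  have L1 : ∀ x ∈ Set.Icc a b, x ≠ a → a' ≤ x := by
    intro x hx hxa
    rcases hall x hx with h | h | h | h
    · exact h ▸ ha'w
    · exact h ▸ ha'z
    · exact lea x ⟨hx, h⟩ hxa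
    · exact ha'w.trans h.1
  have L2 : ∀ x ∈ Set.Icc a b, x ≠ b → x ≤ b' := by
    intro x hx hxa
    rcases hall x hx with h | h | h | h
    · exact h ▸ hb'w
    · exact h ▸ hb'z
    · exact h.1.trans hb'w
    · exact leb x ⟨hx, h⟩ hxa
  have sub : Set.Icc a' b' ⊆ Set.Icc a b := Set.Icc_subset_Icc haa' hb'b
  have eT : {x ∈ Set.Icc a' b' | x ≤ w ∧ x ≤ z} = T \ {a} := by
    ext x
    constructor
    · rintro ⟨hx, h⟩
      refine ⟨⟨sub hx, h⟩, ?_⟩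
      rintro rfl
      exact hne1 (le_antisymm hx.1 haa')
    · rintro ⟨hx, h⟩
      exact ⟨⟨lea x hx h, hx.2.1.trans hb'w⟩, hx.2⟩
  have eN : {x ∈ Set.Icc a' b' | w ≤ x ∧ z ≤ x} = N \ {b} := by
    ext x
    constructor
    · rintro ⟨hx, h⟩
      refine ⟨⟨sub hx, h⟩, ?_⟩
      rintro rfl
      exact hne2 (le_antisymm hb'b hx.2)
    · rintro ⟨hx, h⟩
      exact ⟨⟨ha'w.trans hx.2.1, leb x hx h⟩, hx.2⟩
  refine ⟨a', b', ?_, ?_, ⟨ha'w.trans hb'w, ⟨hm, ⟨ha'w, hb'w⟩, ⟨ha'z, hb'z⟩, hwz, hzw,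
    fun x hx => hall x (sub hx), ?_, ?_, ?_⟩, ?_⟩, L1, L2⟩
  · refine ⟨lt_of_le_of_ne haa' hne1.symm, fun x h1 h2 => ?_⟩
    exact absurd (L1 x ⟨h1.le, h2.le.trans (ha'w.trans hw.2)⟩ h1.ne') h2.not_ge
  · refine ⟨lt_of_le_of_ne hb'b hne2, fun x h1 h2 => ?_⟩
    exact absurd (L2 x ⟨hw.1.trans (hb'w.trans h1.le), h2.le⟩ h2.ne) h1.not_ge
  · rw [eT]; exact hct.mono Set.diff_subset
  · rw [eN]; exact hcn.mono Set.diff_subset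
  · rw [eT, hT1]
  · rw [eN, hN1]

lemma dk_three {P : Type*} [PartialOrder P] [Fintype P] {a b w z : P}
    (h : IsDkIntervalWith 3 a b w z) :
    w ≠ z ∧ a ⋖ w ∧ a ⋖ z ∧ w ⋖ b ∧ z ⋖ b ∧
      (∀ x ∈ Set.Icc a b, x = a ∨ x = b ∨ x = w ∨ x = z) := by
  obtain ⟨hab, ⟨-, hw, hz, hwz, hzw, hall, hct, hcn, hnt⟩, hnn⟩ := h
  obtain ⟨t, ht⟩ := Set.ncard_eq_one.1 hnt
  obtain ⟨n, hn⟩ := Set.ncard_eq_one.1 hnn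
  have haT : a ∈ {x ∈ Set.Icc a b | x ≤ w ∧ x ≤ z} := ⟨⟨le_rfl, hab⟩, hw.1, hz.1⟩
  have hbN : b ∈ {x ∈ Set.Icc a b | w ≤ x ∧ z ≤ x} := ⟨⟨hab, le_rfl⟩, hw.2, hz.2⟩
  rw [ht] at haT
  rw [hn] at hbN
  obtain rfl : a = t := haT
  obtain rfl : b = n := hbN
  have L : ∀ x ∈ Set.Icc a b, x = a ∨ x = b ∨ x = w ∨ x = z := by
    intro x hx
    rcases hall x hx with h | h | h | h
    · simp [h]
    · simp [h]
    · have : x ∈ {x ∈ Set.Icc a b | x ≤ w ∧ x ≤ z} := ⟨hx, h⟩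
      rw [ht] at this
      exact Or.inl this
    · have : x ∈ {x ∈ Set.Icc a b | w ≤ x ∧ z ≤ x} := ⟨hx, h⟩
      rw [hn] at this
      exact Or.inr (Or.inl this)
  have c1 : a ≠ w := by rintro rfl; exact hwz hz.1
  have c2 : a ≠ z := by rintro rfl; exact hzw hw.1
  have c3 : w ≠ b := by rintro rfl; exact hzw hz.2
  have c4 : z ≠ b := by rintro rfl; exact hwz hw.2
  refine ⟨fun e => hwz e.le, ⟨lt_of_le_of_ne hw.1 c1, ?_⟩, ⟨lt_of_le_of_ne hz.1 c2, ?_⟩,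
    ⟨lt_of_le_of_ne hw.2 c3, ?_⟩, ⟨lt_of_le_of_ne hz.2 c4, ?_⟩, L⟩
  · intro x h1 h2
    rcases L x ⟨h1.le, h2.le.trans hw.2⟩ with rfl | rfl | rfl | rfl
    · exact h1.false
    · exact h2.not_ge hw.2
    · exact h2.false
    · exact hzw h2.le
  · intro x h1 h2
    rcases L x ⟨h1.le, h2.le.trans hz.2⟩ with rfl | rfl | rfl | rfl
    · exact h1.false
    · exact h2.not_ge hz.2
    · exact hwz h2.le
    · exact h2.false
  · intro x h1 h2
    rcases L x ⟨hw.1.trans h1.le, h2.le⟩ with rfl | rfl | rfl | rfl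
    · exact h1.not_ge hw.1
    · exact h2.false
    · exact h1.false
    · exact hwz h1.le
  · intro x h1 h2
    rcases L x ⟨hz.1.trans h1.le, h2.le⟩ with rfl | rfl | rfl | rfl
    · exact h1.not_ge hz.1
    · exact h2.false
    · exact hzw h1.le
    · exact h1.false

lemma dk_ge {P : Type*} [PartialOrder P] {k : ℕ} {a b w z : P}
    (h : IsDkIntervalWith k a b w z) : 3 ≤ k := h.2.1.1

lemma minus_three {P : Type*} [PartialOrder P] {x u v : P} (hu : x ⋖ u) (hv : x ⋖ v)
    (huv : u ≠ v) : IsDkMinusConvex 3 ({x, u, v} : Set P) := by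
  have n1 : ¬ u ≤ v := fun h => hv.2 hu.1 (lt_of_le_of_ne h huv)
  have n2 : ¬ v ≤ u := fun h => hu.2 hv.1 (lt_of_le_of_ne h huv.symm)
  have eT : {y ∈ ({x, u, v} : Set P) | y ≤ u ∧ y ≤ v} = {x} := by
    ext y
    simp only [Set.mem_insert_iff, Set.mem_singleton_iff, Set.mem_setOf_eq]
    constructor
    · rintro ⟨rfl | rfl | rfl, h1, h2⟩
      · rfl
      · exact absurd h2 n1
      · exact absurd h1 n2
    · rintro rfl
      exact ⟨Or.inl rfl, hu.le, hv.le⟩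
  have eN : {y ∈ ({x, u, v} : Set P) | u ≤ y ∧ v ≤ y} = ∅ := by
    ext y
    simp only [Set.mem_insert_iff, Set.mem_singleton_iff, Set.mem_setOf_eq,
      Set.mem_empty_iff_false, iff_false]
    rintro ⟨rfl | rfl | rfl, h1, h2⟩
    · exact hu.lt.not_ge h1
    · exact n2 h2
    · exact n1 h1
  refine ⟨?_, u, v, ⟨le_rfl, by simp, by simp, n1, n2, ?_, ?_, ?_, ?_⟩, ?_⟩
  · intro a ha b hb y h1 h2
    have hxy : x ≤ y := by
      rcases ha with rfl | rfl | rfl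
      · exact h1
      · exact hu.le.trans h1
      · exact hv.le.trans h1
    by_cases e : y = x
    · simp [e]
    have hlt : x < y := lt_of_le_of_ne hxy (Ne.symm e)
    rcases hb with rfl | rfl | rfl
    · exact absurd h2 hlt.not_ge
    · by_cases e' : y = b
      · simp [e']
      · exact absurd (lt_of_le_of_ne h2 e') (hu.2 hlt)
    · by_cases e' : y = b
      · simp [e']
      · exact absurd (lt_of_le_of_ne h2 e') (hv.2 hlt)
  · rintro y (rfl | rfl | rfl)
    · exact Or.inr (Or.inr (Or.inl ⟨hu.le, hv.le⟩))
    · exact Or.inl rfl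
    · exact Or.inr (Or.inl rfl)
  · rw [eT]; exact Set.subsingleton_singleton.isChain
  · rw [eN]; exact Set.subsingleton_empty.isChain
  · rw [eT]; simp
  · rw [eN]; simp

lemma minus_succ {P : Type*} [PartialOrder P] [Fintype P] {k : ℕ} {x n r : P}
    (h : IsDkInterval k n r) (hx : x < n) (hc : ∀ y, x ≤ y → y ≤ r → y = x ∨ n ≤ y) :
    IsDkMinusConvex (k+1) (insert x (Set.Icc n r)) := by
  obtain ⟨w, z, hnr, ⟨hk, hw, hz, hwz, hzw, hall, hct, hcn, hnt⟩, hnn⟩ := h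
  have eT : {y ∈ insert x (Set.Icc n r) | y ≤ w ∧ y ≤ z} =
      insert x {y ∈ Set.Icc n r | y ≤ w ∧ y ≤ z} := by
    ext y
    constructor
    · rintro ⟨rfl | h, h'⟩
      · exact Or.inl rfl
      · exact Or.inr ⟨h, h'⟩
    · rintro (rfl | h)
      · exact ⟨Or.inl rfl, hx.le.trans hw.1, hx.le.trans hz.1⟩
      · exact ⟨Or.inr h.1, h.2⟩
  have eN : {y ∈ insert x (Set.Icc n r) | w ≤ y ∧ z ≤ y} =
      {y ∈ Set.Icc n r | w ≤ y ∧ z ≤ y} := by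
    ext y
    constructor
    · rintro ⟨rfl | h, h'⟩
      · exact absurd (hw.1.trans h'.1) hx.not_ge
      · exact ⟨h, h'⟩
    · rintro h
      exact ⟨Or.inr h.1, h.2⟩
  have hxn : x ∉ {y ∈ Set.Icc n r | y ≤ w ∧ y ≤ z} := fun h => hx.not_ge h.1.1
  refine ⟨?_, w, z, ⟨by omega, Or.inr hw, Or.inr hz, hwz, hzw, ?_, ?_, ?_, ?_⟩, ?_⟩
  · intro a ha b hb y h1 h2
    have hxy : x ≤ y := by
      rcases ha with rfl | ha
      · exact h1
      · exact hx.le.trans (ha.1.trans h1)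
    have hyr : y ≤ r := by
      rcases hb with rfl | hb
      · exact h2.trans (hx.le.trans hnr)
      · exact h2.trans hb.2
    rcases hc y hxy hyr with h | h
    · exact Or.inl h
    · exact Or.inr ⟨h, hyr⟩
  · rintro y (rfl | h)
    · exact Or.inr (Or.inr (Or.inl ⟨hx.le.trans hw.1, hx.le.trans hz.1⟩))
    · exact hall y h
  · rw [eT]
    exact hct.insert (fun b hb _ => Or.inl (hx.le.trans hb.1.1))
  · rw [eN]; exact hcn
  · rw [eT, Set.ncard_insert_of_notMem hxn, hnt]; omega
  · rw [eN, hnn]; omega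

lemma completion {P : Type*} [PartialOrder P] [Fintype P] (hP : IsDComplete P) {k : ℕ}
    {S : Set P} {x : P} (h : IsDkMinusConvex k S) (hx : x ∈ S) (hmin : ∀ y ∈ S, x ≤ y) :
    ∃ r, r ∉ S ∧ IsDkInterval k x r ∧ Set.Icc x r = insert r S ∧ ∀ c, c ⋖ r → c ∈ S := by
  obtain ⟨r, hr, a, hI, e⟩ := hP.1 k S h
  have hxI : x ∈ Set.Icc a r := by rw [e]; exact Or.inr hx
  have haI : a ∈ Set.Icc a r := ⟨le_rfl, hxI.1.trans hxI.2⟩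
  have hxa : x = a := by
    have := haI
    rw [e] at this
    rcases this with h | h
    · exact absurd (le_antisymm hxI.2 (h ▸ hxI.1)) (fun h => hr (h ▸ hx))
    · exact le_antisymm (hmin _ h) hxI.1
  subst hxa
  refine ⟨r, hr, hI, e, fun c hc => ?_⟩
  have := hP.2.1 x r ⟨k, hI⟩ c hc
  rw [e] at this
  rcases this with h | h
  · exact absurd h hc.lt.ne
  · exact h

lemma completion3 {P : Type*} [PartialOrder P] [Fintype P] (hP : IsDComplete P)
    {x u v : P} (hu : x ⋖ u) (hv : x ⋖ v) (huv : u ≠ v) :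
    ∃ r, IsDkInterval 3 x r ∧ u ⋖ r ∧ v ⋖ r ∧ (∀ c, c ⋖ r → c = u ∨ c = v) := by
  have n1 : ¬ u ≤ v := fun h => hv.2 hu.1 (lt_of_le_of_ne h huv)
  have n2 : ¬ v ≤ u := fun h => hu.2 hv.1 (lt_of_le_of_ne h huv.symm)
  obtain ⟨r, hr, hI, e, hc⟩ := completion hP (minus_three hu hv huv) (x := x) (by simp) (by
    rintro y (rfl | rfl | rfl)
    · rfl
    · exact hu.le
    · exact hv.le)
  have hur : u ∈ Set.Icc x r := by rw [e]; simp
  have hvr : v ∈ Set.Icc x r := by rw [e]; simp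
  have hcu : u ⋖ r := by
    refine ⟨lt_of_le_of_ne hur.2 (by rintro rfl; simp at hr), fun y h1 h2 => ?_⟩
    have : y ∈ Set.Icc x r := ⟨hu.le.trans h1.le, h2.le⟩
    rw [e] at this
    rcases this with rfl | rfl | rfl | rfl
    · exact h2.false
    · exact h1.not_ge hu.le
    · exact h1.false
    · exact n1 h1.le
  have hcv : v ⋖ r := by
    refine ⟨lt_of_le_of_ne hvr.2 (by rintro rfl; simp at hr), fun y h1 h2 => ?_⟩
    have : y ∈ Set.Icc x r := ⟨hv.le.trans h1.le, h2.le⟩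
    rw [e] at this
    rcases this with rfl | rfl | rfl | rfl
    · exact h2.false
    · exact h1.not_ge hv.le
    · exact n2 h1.le
    · exact h1.false
  refine ⟨r, hI, hcu, hcv, fun c h => ?_⟩
  rcases hc c h with rfl | rfl | rfl
  · exact absurd hcu.lt (h.2 hu.lt)
  · exact Or.inl rfl
  · exact Or.inr rfl

lemma no_triple {P : Type*} [PartialOrder P] [Fintype P] (hP : IsDComplete P) (A : P) :
    ∀ B C x y z : P, A ≠ B → A ≠ C → B ≠ C → x ⋖ A → x ⋖ B → y ⋖ A → y ⋖ C →
      z ⋖ B → z ⋖ C → False := by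
  induction A using (wellFounded_gt (α := P)).induction with
  | _ A ih =>
  intro B C x y z hAB hAC hBC xA xB yA yC zB zC
  obtain ⟨r, -, r1, r2, r3⟩ := completion3 hP xA xB hAB
  obtain ⟨s, -, s1, s2, s3⟩ := completion3 hP yA yC hAC
  obtain ⟨t, -, t1, t2, t3⟩ := completion3 hP zB zC hBC
  refine ih r r1.lt s t A B C ?_ ?_ ?_ r1 s1 r2 t1 s2 t2
  · rintro rfl
    rcases r3 C s2 with h | h
    · exact hAC h.symm
    · exact hBC h.symm
  · rintro rfl
    rcases r3 C t2 with h | h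
    · exact hAC h.symm
    · exact hBC h.symm
  · rintro rfl
    rcases s3 B t1 with h | h
    · exact hAB h.symm
    · exact hBC h

lemma two_covers {P : Type*} [PartialOrder P] [Fintype P] (hP : IsDComplete P) {p u v y : P}
    (hu : p ⋖ u) (hv : p ⋖ v) (huv : u ≠ v) (hy : p ⋖ y) : y = u ∨ y = v := by
  by_contra! h
  exact no_triple hP u v y p p p huv h.1.symm h.2.symm hu hv hu hy hv hy

lemma cover_le {P : Type*} [PartialOrder P] [Fintype P] (hP : IsDComplete P) (k : ℕ) (hk : 3 ≤ k) :
    ∀ p q w z y : P, IsDkIntervalWith k p q w z → p ⋖ y → y ≤ q := by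
  induction k, hk using Nat.le_induction with
  | base =>
    intro p q w z y h hy
    obtain ⟨hwz, h1, h2, h3, h4, -⟩ := dk_three h
    rcases two_covers hP h1 h2 hwz hy with rfl | rfl
    · exact h3.le
    · exact h4.le
  | succ m hm ih =>
    intro p q w z y h hy
    obtain ⟨a', b', ha, hb, h', -, -⟩ := dk_peel hm h
    by_cases e : a' = y
    · subst e
      exact h'.1.trans hb.le
    · obtain ⟨r, -, r1, r2, -⟩ := completion3 hP ha hy e
      exact r2.le.trans ((ih a' b' w z r h' r1).trans hb.le)

lemma below_cover {P : Type*} [PartialOrder P] [Fintype P] {y r : P} (h : y ≤ r) :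
    y = r ∨ ∃ c, y ≤ c ∧ c ⋖ r := by
  rcases h.eq_or_lt with h | h
  · exact Or.inl h
  · exact Or.inr (exists_le_covBy_of_lt h)

lemma tower {P : Type*} [PartialOrder P] [Fintype P] (hP : IsDComplete P) (k : ℕ) (hk : 3 ≤ k) :
    ∀ (a n w z : P) (j : ℕ) (r : P), IsDkIntervalWith k a n w z → IsDkInterval j n r →
      (∀ y, y ≤ r → y ≤ n ∨ n ≤ y) → False := by
  have key : ∀ (x n r : P), x ⋖ n → (∀ y, y ≤ r → y ≤ n ∨ n ≤ y) →
      ∀ y, x ≤ y → y ≤ r → y = x ∨ n ≤ y := by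
    intro x n r hx hl y h1 h2
    rcases hl y h2 with h | h
    · by_cases e : y = x
      · exact Or.inl e
      · by_cases e' : y = n
        · exact Or.inr e'.ge
        · exact absurd (lt_of_le_of_ne h e') (hx.2 (lt_of_le_of_ne h1 (Ne.symm e)))
    · exact Or.inr h
  have hmin : ∀ (x n r : P), x ⋖ n → ∀ y ∈ insert x (Set.Icc n r), x ≤ y := by
    rintro x n r hx y (rfl | h)
    · rfl
    · exact hx.le.trans h.1
  have hdiff : ∀ (x n r : P), x ⋖ n → insert x (Set.Icc n r) \ {x} = Set.Icc n r := by
    intro x n r hx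
    exact Set.insert_diff_self_of_notMem (fun h => hx.lt.not_ge h.1)
  induction k, hk using Nat.le_induction with
  | base =>
    intro a n w z j r h hj hl
    obtain ⟨hwz, -, -, h3, h4, -⟩ := dk_three h
    have e := hP.2.2 _ _ _ _ (minus_succ hj h3.lt (key w n r h3 hl))
      (minus_succ hj h4.lt (key z n r h4 hl)) w (Or.inl rfl) z (Or.inl rfl)
      (hmin w n r h3) (hmin z n r h4) (by rw [hdiff w n r h3, hdiff z n r h4])
    have : w ∈ insert z (Set.Icc n r) := e ▸ Or.inl rfl
    rcases this with h | h
    · exact hwz h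
    · exact h3.lt.not_ge h.1
  | succ m hm ih =>
    intro a n w z j r h hj hl
    obtain ⟨a', b', ha, hb, h', L1, L2⟩ := dk_peel hm h
    obtain ⟨r', hr', hI, e, hc⟩ := completion hP (minus_succ hj hb.lt (key b' n r hb hl))
      (Or.inl rfl) (hmin b' n r hb)
    refine ih a' b' w z (j+1) r' h' hI ?_
    intro y hy
    rcases below_cover hy with rfl | ⟨c, hyc, hcr⟩
    · obtain ⟨w, z, h, -⟩ := hI
      exact Or.inr h
    rcases hc c hcr with rfl | hcI
    · exact Or.inl hyc
    rcases hl y (hyc.trans hcI.2) with h1 | h1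
    · rcases below_cover h1 with rfl | ⟨c', hyc', hc'⟩
      · exact Or.inr hb.le
      · exact Or.inl (hyc'.trans (L2 c' (hP.2.1 a n ⟨_, _, _, h⟩ c' hc') hc'.lt.ne))
    · exact Or.inr (hb.le.trans h1)

lemma no_three_big {P : Type*} [PartialOrder P] [Fintype P] (hP : IsDComplete P) {m : ℕ}
    (hm : 3 ≤ m) {p q q' w z w' z' : P} (h : IsDkIntervalWith 3 p q w z)
    (h' : IsDkIntervalWith (m+1) p q' w' z') : False := by
  obtain ⟨hwz, h1, h2, -⟩ := dk_three h
  obtain ⟨t, b, ht, hb, -, L1, -⟩ := dk_peel hm h'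
  have e : ∀ y, p ⋖ y → y = t := by
    intro y hy
    have := L1 y ⟨hy.le, cover_le hP _ (dk_ge h') _ _ _ _ _ h' hy⟩ hy.lt.ne'
    by_contra hne
    exact hy.2 ht.lt (lt_of_le_of_ne this (Ne.symm hne))
  exact hwz ((e w h1).trans (e z h2).symm)

lemma uniq_top {P : Type*} [PartialOrder P] [Fintype P] (hP : IsDComplete P) (k : ℕ) (hk : 3 ≤ k) :
    ∀ (p q w z : P) (l : ℕ) (q' w' z' : P), IsDkIntervalWith k p q w z →
      IsDkIntervalWith l p q' w' z' → q = q' := by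
  induction k, hk using Nat.le_induction with
  | base =>
    intro p q w z l q' w' z' h h'
    rcases (dk_ge h').eq_or_lt with rfl | hl
    · obtain ⟨hwz, h1, h2, h3, h4, -⟩ := dk_three h
      obtain ⟨hwz', h1', h2', h3', h4', -⟩ := dk_three h'
      have c1 : w ⋖ q' := by
        rcases two_covers hP h1' h2' hwz' h1 with rfl | rfl
        · exact h3'
        · exact h4'
      have c2 : z ⋖ q' := by
        rcases two_covers hP h1' h2' hwz' h2 with rfl | rfl
        · exact h3'
        · exact h4'
      by_contra hne
      have d : ∀ x, x ⋖ q → x ⋖ q' → ({x, q, q'} : Set P) \ {x} = {q, q'} := by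
        intro x hx hx'
        apply Set.insert_diff_self_of_notMem
        rintro (h | h)
        · exact hx.lt.ne h
        · exact hx'.lt.ne h
      have hm : ∀ x, x ⋖ q → x ⋖ q' → ∀ y ∈ ({x, q, q'} : Set P), x ≤ y := by
        rintro x hx hx' y (rfl | rfl | rfl)
        · rfl
        · exact hx.le
        · exact hx'.le
      have e := hP.2.2 _ _ _ _ (minus_three h3 c1 hne) (minus_three h4 c2 hne) w (Or.inl rfl)
        z (Or.inl rfl) (hm w h3 c1) (hm z h4 c2) (by rw [d w h3 c1, d z h4 c2])
      have : w ∈ ({z, q, q'} : Set P) := e ▸ Or.inl rfl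
      rcases this with h | h | h
      · exact hwz h
      · exact h3.lt.ne h
      · exact c1.lt.ne h
    · obtain ⟨m, rfl⟩ : ∃ m, l = m + 1 := ⟨l - 1, by omega⟩
      exact (no_three_big hP (by omega) h h').elim
  | succ m hm ih =>
    intro p q w z l q' w' z' h h'
    rcases (dk_ge h').eq_or_lt with rfl | hl
    · exact (no_three_big hP hm h' h).elim
    obtain ⟨l, rfl⟩ : ∃ m, l = m + 1 := ⟨l - 1, by omega⟩
    obtain ⟨t, n, ht, hn, g, L1, L2⟩ := dk_peel hm h
    obtain ⟨t', n', ht', hn', g', L1', L2'⟩ := dk_peel (by omega) h'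
    have e : t' = t := by
      have := L1 t' ⟨ht'.le, cover_le hP _ (dk_ge h) _ _ _ _ _ h ht'⟩ ht'.lt.ne'
      by_contra hne
      exact ht'.2 ht.lt (lt_of_le_of_ne this (Ne.symm hne))
    subst e
    obtain rfl := ih _ _ _ _ _ _ _ _ g g'
    by_contra hne
    obtain ⟨r, hI, r1, r2, r3⟩ := completion3 hP hn hn' hne
    refine tower hP m hm _ _ _ _ _ _ g hI ?_
    intro y hy
    rcases below_cover hy with rfl | ⟨c, hyc, hcr⟩
    · exact Or.inr (hn.le.trans r1.le)
    rcases r3 c hcr with rfl | rfl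
    · rcases below_cover hyc with rfl | ⟨c', hyc', hc'⟩
      · exact Or.inr hn.le
      · exact Or.inl (hyc'.trans (L2 c' (hP.2.1 _ _ ⟨_, _, _, h⟩ c' hc') hc'.lt.ne))
    · rcases below_cover hyc with rfl | ⟨c', hyc', hc'⟩
      · exact Or.inr hn'.le
      · exact Or.inl (hyc'.trans (L2' c' (hP.2.1 _ _ ⟨_, _, _, h'⟩ c' hc') hc'.lt.ne))

lemma tail_sub {P : Type*} [PartialOrder P] [Fintype P] (k : ℕ) (hk : 3 ≤ k) :
    ∀ (p a b w z : P), IsDkIntervalWith k a b w z → p ∈ Set.Icc a b → p ≤ w → p ≤ z →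
      ∃ b', b' ≤ b ∧ IsDInterval p b' := by
  induction k, hk using Nat.le_induction with
  | base =>
    intro p a b w z h hp hw hz
    have hh := h
    obtain ⟨-, ⟨-, -, -, hwz, hzw, -⟩, -⟩ := hh
    obtain ⟨-, h1, h2, h3, h4, h5⟩ := dk_three h
    rcases h5 p hp with rfl | rfl | rfl | rfl
    · exact ⟨b, le_rfl, _, _, _, h⟩
    · exact absurd hw h3.lt.not_ge
    · exact absurd hz hwz
    · exact absurd hw hzw
  | succ m hm ih =>
    intro p a b w z h hp hw hz
    obtain ⟨a', b', ha, hb, h', L1, L2⟩ := dk_peel hm h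
    by_cases e : p = a
    · subst e
      exact ⟨b, le_rfl, _, _, _, h⟩
    · obtain ⟨c, hc, hI⟩ := ih p a' b' w z h' ⟨L1 p hp e, hw.trans h'.2.1.2.1.2⟩ hw hz
      exact ⟨c, hc.trans hb.le, hI⟩

/-- If `p` is the minimal element of some `d`-interval of a d-complete poset,
then it is the minimal element of a unique `d`-interval `[p, q']`, and any
`d`-interval having `p` as a tail element contains `[p, q']`. -/
theorem unique_d_interval_with_min {P : Type*} [PartialOrder P] [Fintype P]
    (hP : IsDComplete P) (p : P) (hp : ∃ q', IsDInterval p q') :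
    ∃ q', IsDInterval p q' ∧ (∀ q'', IsDInterval p q'' → q'' = q') ∧
      ∀ a b : P, IsTailOf p a b → Set.Icc p q' ⊆ Set.Icc a b := by
  obtain ⟨q, hq⟩ := hp
  have U : ∀ q'', IsDInterval p q'' → q'' = q := by
    rintro q'' ⟨l, w', z', h'⟩
    obtain ⟨k, w, z, h⟩ := hq
    exact uniq_top hP l (dk_ge h') _ _ _ _ _ _ _ _ h' h
  refine ⟨q, hq, U, ?_⟩
  rintro a b ⟨k, w, z, h, hpI, hw, hz⟩
  obtain ⟨b', hb', hI⟩ := tail_sub k (dk_ge h) p a b w z h hpI hw hz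
  obtain rfl := U b' hI
  exact Set.Icc_subset_Icc hpI.1 hb'
end

section
/- Let P' be an upper set of a d-complete poset P, and let C, D be two diagonals of P each having nonempty intersection with P'. Then C ∩ P' and D ∩ P' are adjacent diagonals of P' if and only if C and D are adjacent diagonals of P. -/
variable {P : Type*} [PartialOrder P]

/-- Two elements are in the same diagonal: the equivalence relation generated by
`p ∼ q` whenever `[p, q]` is a `d`-interval. -/
def DiagRel {P : Type*} [PartialOrder P] (a b : P) : Prop :=
  Relation.EqvGen (fun x y => IsDInterval x y) a b

/-- The setoid on `P` whose classes are the diagonals. -/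
def diagSetoid (P : Type*) [PartialOrder P] : Setoid P :=
  ⟨DiagRel, Relation.EqvGen.is_equivalence _⟩

/-- `h` is the hook-vector function of the d-complete poset `P`, indexed by
diagonals (the quotient of `P` by `DiagRel`): if `p` is not a neck element of any
`d`-interval then `h p D` counts the elements of the diagonal `D` weakly below `p`;
and if `[p', p]` is a `d`-interval with side elements `w`, `z`, then
`h p = h w + h z - h p'`. -/
def IsHookVector {P : Type*} [PartialOrder P]
    (h : P → Quotient (diagSetoid P) → ℤ) : Prop :=
  (∀ p : P, (¬ ∃ a b : P, IsNeckOf p a b) → ∀ D,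
      h p D = ({r : P | Quotient.mk (diagSetoid P) r = D ∧ r ≤ p}).ncard) ∧
  (∀ p' p w z : P, IsDIntervalWith p' p w z → ∀ D,
      h p D = h w D + h z D - h p' D)

/-- A linear extension of `P`, as an enumeration `e 0 > e 1 > ⋯` refining the
partial order: each initial segment is an upper set. -/
def IsLinExt {P : Type*} [PartialOrder P] [Fintype P]
    (e : Fin (Fintype.card P) ≃ P) : Prop :=
  ∀ i j, e i < e j → j < i


theorem aux_peel {P : Type*} [PartialOrder P] [Finite P] {k : ℕ} {a b : P}
    (h : IsDkInterval k a b) :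
    (k = 3 ∧ ∃ w z, w ≠ z ∧ a ⋖ w ∧ a ⋖ z ∧ w ⋖ b ∧ z ⋖ b ∧
      ∀ x, a ≤ x → x ≤ b → x = a ∨ x = w ∨ x = z ∨ x = b) ∨
    (4 ≤ k ∧ ∃ t n, IsDkInterval (k - 1) t n ∧ a ⋖ t ∧ n ⋖ b ∧ t < n ∧
      ∀ x, a ≤ x → x ≤ b → x = a ∨ x = b ∨ (t ≤ x ∧ x ≤ n)) := by
  obtain ⟨w, z, hab, ⟨hk, hw, hz, hwz, hzw, hS, hT, hN, hTc⟩, hNc⟩ := h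
  have haw : a < w := lt_of_le_of_ne hw.1 (fun e => hwz (e ▸ hz.1))
  have haz : a < z := lt_of_le_of_ne hz.1 (fun e => hzw (e ▸ hw.1))
  have hwb : w < b := lt_of_le_of_ne hw.2 (fun e => hzw (e ▸ hz.2))
  have hzb : z < b := lt_of_le_of_ne hz.2 (fun e => hwz (e ▸ hw.2))
  set T := {x ∈ Set.Icc a b | x ≤ w ∧ x ≤ z} with hTdef
  set N := {x ∈ Set.Icc a b | w ≤ x ∧ z ≤ x} with hNdef
  have haT : a ∈ T := ⟨⟨le_rfl, hab⟩, haw.le, haz.le⟩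
  have hbN : b ∈ N := ⟨⟨hab, le_rfl⟩, hwb.le, hzb.le⟩
  rcases Nat.lt_or_ge k 4 with h4 | h4
  · left
    have hk3 : k = 3 := by omega
    subst hk3
    refine ⟨rfl, w, z, fun e => hwz e.le, ?_⟩
    obtain ⟨a', ha'⟩ := Set.ncard_eq_one.mp hTc
    obtain ⟨b', hb'⟩ := Set.ncard_eq_one.mp hNc
    have e1 : a = a' := by rw [ha'] at haT; exact haT
    have e2 : b = b' := by rw [hb'] at hbN; exact hbN
    subst e1 e2
    have key : ∀ x, a ≤ x → x ≤ b → x = a ∨ x = w ∨ x = z ∨ x = b := by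
      intro x h1 h2
      rcases hS x ⟨h1, h2⟩ with h | h | h | h
      · exact Or.inr (Or.inl h)
      · exact Or.inr (Or.inr (Or.inl h))
      · left
        have : x ∈ T := ⟨⟨h1, h2⟩, h⟩
        rw [ha'] at this; exact this
      · right; right; right
        have : x ∈ N := ⟨⟨h1, h2⟩, h⟩
        rw [hb'] at this; exact this
    refine ⟨⟨haw, ?_⟩, ⟨haz, ?_⟩, ⟨hwb, ?_⟩, ⟨hzb, ?_⟩, key⟩
    · intro x h1 h2
      rcases key x h1.le (h2.le.trans hwb.le) with rfl | rfl | rfl | rfl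
      · exact h1.false
      · exact h2.false
      · exact hzw h2.le
      · exact (h2.trans hwb).false
    · intro x h1 h2
      rcases key x h1.le (h2.le.trans hzb.le) with rfl | rfl | rfl | rfl
      · exact h1.false
      · exact hwz h2.le
      · exact h2.false
      · exact (h2.trans hzb).false
    · intro x h1 h2
      rcases key x (haw.le.trans h1.le) h2.le with rfl | rfl | rfl | rfl
      · exact (h1.trans haw).false
      · exact h1.false
      · exact hwz h1.le
      · exact h2.false
    · intro x h1 h2
      rcases key x (haz.le.trans h1.le) h2.le with rfl | rfl | rfl | rfl
      · exact (h1.trans haz).false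
      · exact hzw h1.le
      · exact h1.false
      · exact h2.false
  · right
    refine ⟨h4, ?_⟩
    have hT1 : (T \ {a}).ncard = k - 3 := by
      rw [Set.ncard_sdiff_singleton_of_mem haT, hTc]; omega
    have hN1 : (N \ {b}).ncard = k - 3 := by
      rw [Set.ncard_sdiff_singleton_of_mem hbN, hNc]; omega
    have hTne : (T \ {a}).Nonempty := by
      apply Set.nonempty_of_ncard_ne_zero; omega
    have hNne : (N \ {b}).Nonempty := by
      apply Set.nonempty_of_ncard_ne_zero; omega
    obtain ⟨t, ht⟩ := (Set.toFinite (T \ {a})).exists_minimal hTne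
    obtain ⟨n, hn⟩ := (Set.toFinite (N \ {b})).exists_maximal hNne
    have htT := ht.prop
    have hnN := hn.prop
    have htmin : ∀ x ∈ T, x ≠ a → t ≤ x := by
      intro x hx hxa
      rcases hT.total htT.1 hx with h | h
      · exact h
      · exact ht.le_of_le ⟨hx, hxa⟩ h
    have hnmax : ∀ x ∈ N, x ≠ b → x ≤ n := by
      intro x hx hxa
      rcases hN.total hnN.1 hx with h | h
      · exact hn.le_of_ge ⟨hx, hxa⟩ h
      · exact h
    have hat : a < t := lt_of_le_of_ne htT.1.1.1 (fun e => htT.2 e.symm)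
    have hnb : n < b := lt_of_le_of_ne hnN.1.1.2 hnN.2
    have htw : t ≤ w := htT.1.2.1
    have htz : t ≤ z := htT.1.2.2
    have hwn : w ≤ n := hnN.1.2.1
    have hzn : z ≤ n := hnN.1.2.2
    have htn : t < n := lt_of_le_of_ne (htw.trans hwn) (by
      rintro rfl; exact hwz (hwn.trans htz))
    have key : ∀ x, a ≤ x → x ≤ b → x = a ∨ x = b ∨ (t ≤ x ∧ x ≤ n) := by
      intro x h1 h2
      by_cases hxa : x = a
      · exact Or.inl hxa
      by_cases hxb : x = b
      · exact Or.inr (Or.inl hxb)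
      right; right
      rcases hS x ⟨h1, h2⟩ with rfl | rfl | h | h
      · exact ⟨htw, hwn⟩
      · exact ⟨htz, hzn⟩
      · exact ⟨htmin x ⟨⟨h1, h2⟩, h⟩ hxa, h.1.trans hwn⟩
      · exact ⟨htw.trans h.1, hnmax x ⟨⟨h1, h2⟩, h⟩ hxb⟩
    have hsub : ∀ x ∈ Set.Icc t n, x ∈ Set.Icc a b := fun x hx =>
      ⟨hat.le.trans hx.1, hx.2.trans hnb.le⟩
    have eT : {x ∈ Set.Icc t n | x ≤ w ∧ x ≤ z} = T \ {a} := by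
      ext x
      constructor
      · rintro ⟨h1, h2⟩
        exact ⟨⟨hsub x h1, h2⟩, (hat.trans_le h1.1).ne'⟩
      · rintro ⟨h1, h2⟩
        exact ⟨⟨htmin x h1 h2, h1.2.1.trans hwn⟩, h1.2⟩
    have eN : {x ∈ Set.Icc t n | w ≤ x ∧ z ≤ x} = N \ {b} := by
      ext x
      constructor
      · rintro ⟨h1, h2⟩
        exact ⟨⟨hsub x h1, h2⟩, (h1.2.trans_lt hnb).ne⟩
      · rintro ⟨h1, h2⟩
        exact ⟨⟨htw.trans h1.2.1, hnmax x h1 h2⟩, h1.2⟩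
    refine ⟨t, n, ⟨w, z, htn.le, ⟨by omega, ⟨htw, hwn⟩, ⟨htz, hzn⟩, hwz, hzw,
      fun x hx => hS x (hsub x hx), ?_, ?_, ?_⟩, ?_⟩, ⟨hat, ?_⟩, ⟨hnb, ?_⟩, htn, key⟩
    · rw [eT]; exact hT.mono Set.sdiff_subset
    · rw [eN]; exact hN.mono Set.sdiff_subset
    · rw [eT, hT1]; omega
    · rw [eN, hN1]; omega
    · intro x h1 h2
      rcases key x h1.le (h2.le.trans (htn.trans hnb).le) with rfl | rfl | h
      · exact h1.false
      · exact (h2.trans (htn.trans hnb)).false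
      · exact (h2.trans_le h.1).false
    · intro x h1 h2
      rcases key x ((hat.trans htn).le.trans h1.le) h2.le with rfl | rfl | h
      · exact (h1.trans (hat.trans htn)).false
      · exact h2.false
      · exact (h1.trans_le h.2).false

/-- completing above -/
theorem aux_complete {P : Type*} [PartialOrder P] (hP : IsDComplete P) {k : ℕ} {S : Set P}
    (hS : IsDkMinusConvex k S) {a : P} (ha : a ∈ S) (hmin : ∀ x ∈ S, a ≤ x) :
    ∃ b, b ∉ S ∧ IsDkInterval k a b ∧ Set.Icc a b = insert b S := by
  obtain ⟨b, hb, a', h1, h2⟩ := hP.1 k S hS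
  have haa : a ∈ Set.Icc a' b := by rw [h2]; exact Or.inr ha
  have ha' : a' ∈ insert b S := by
    rw [← h2]; exact ⟨le_rfl, haa.1.trans haa.2⟩
  rcases ha' with e | e
  · subst e
    exact absurd (le_antisymm haa.1 haa.2 ▸ ha) hb
  · have : a = a' := le_antisymm (hmin _ e) haa.1
    subst this
    exact ⟨b, hb, h1, h2⟩

theorem aux_minus3 {P : Type*} [PartialOrder P] {a w z : P}
    (hwz : w ≠ z) (hw : a ⋖ w) (hz : a ⋖ z) : IsDkMinusConvex 3 ({a, w, z} : Set P) := by
  have h1 : ¬ w ≤ z := fun h => hz.2 hw.lt (lt_of_le_of_ne h hwz)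
  have h2 : ¬ z ≤ w := fun h => hw.2 hz.lt (lt_of_le_of_ne h hwz.symm)
  have hT : {x ∈ ({a, w, z} : Set P) | x ≤ w ∧ x ≤ z} = {a} := by
    ext x
    constructor
    · rintro ⟨rfl | rfl | rfl, h3, h4⟩
      · rfl
      · exact absurd h4 h1
      · exact absurd h3 h2
    · rintro rfl
      exact ⟨Or.inl rfl, hw.le, hz.le⟩
  have hN : {x ∈ ({a, w, z} : Set P) | w ≤ x ∧ z ≤ x} = ∅ := by
    ext x
    constructor
    · rintro ⟨rfl | rfl | rfl, h3, h4⟩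
      · exact absurd hw.lt h3.not_gt
      · exact absurd h4 h2
      · exact absurd h3 h1
    · rintro ⟨⟩
  refine ⟨?_, w, z, ⟨le_rfl, by simp, by simp, h1, h2, ?_, ?_, ?_, ?_⟩, ?_⟩
  · intro p hp q hq x hx hx'
    have hax : a ≤ x := by
      rcases hp with rfl | rfl | rfl
      · exact hx
      · exact hw.le.trans hx
      · exact hz.le.trans hx
    rcases hax.eq_or_lt with rfl | hax
    · simp
    rcases hq with rfl | rfl | rfl
    · exact absurd hax hx'.not_gt
    · rcases hx'.eq_or_lt with rfl | h
      · simp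
      · exact absurd h (hw.2 hax)
    · rcases hx'.eq_or_lt with rfl | h
      · simp
      · exact absurd h (hz.2 hax)
  · rintro x (rfl | rfl | rfl)
    · exact Or.inr (Or.inr (Or.inl ⟨hw.le, hz.le⟩))
    · exact Or.inl rfl
    · exact Or.inr (Or.inl rfl)
  · rw [hT]; exact IsChain.singleton
  · rw [hN]; exact IsChain.empty
  · rw [hT]; simp
  · rw [hN]; simp

theorem aux_1a {P : Type*} [PartialOrder P] (hP : IsDComplete P) {a w z : P}
    (hwz : w ≠ z) (hw : a ⋖ w) (hz : a ⋖ z) :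
    ∃ b, IsDkInterval 3 a b ∧ w ⋖ b ∧ z ⋖ b ∧
      ∀ x, a ≤ x → x ≤ b → x = a ∨ x = w ∨ x = z ∨ x = b := by
  obtain ⟨b, hb, h1, h2⟩ := aux_complete hP (aux_minus3 hwz hw hz) (a := a) (by simp)
    (by rintro x (rfl | rfl | rfl); exacts [le_rfl, hw.le, hz.le])
  have n1 : ¬ w ≤ z := fun h => hz.2 hw.lt (lt_of_le_of_ne h hwz)
  have n2 : ¬ z ≤ w := fun h => hw.2 hz.lt (lt_of_le_of_ne h hwz.symm)
  have key : ∀ x, a ≤ x → x ≤ b → x = a ∨ x = w ∨ x = z ∨ x = b := by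
    intro x h3 h4
    have : x ∈ insert b ({a, w, z} : Set P) := by rw [← h2]; exact ⟨h3, h4⟩
    rcases this with h | h | h | h
    · exact Or.inr (Or.inr (Or.inr h))
    · exact Or.inl h
    · exact Or.inr (Or.inl h)
    · exact Or.inr (Or.inr (Or.inl h))
  have hwb : w < b := by
    have : w ∈ Set.Icc a b := by rw [h2]; simp
    exact lt_of_le_of_ne this.2 (by rintro rfl; simp at hb)
  have hzb : z < b := by
    have : z ∈ Set.Icc a b := by rw [h2]; simp
    exact lt_of_le_of_ne this.2 (by rintro rfl; simp at hb)
  refine ⟨b, h1, ⟨hwb, ?_⟩, ⟨hzb, ?_⟩, key⟩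
  · intro x h3 h4
    rcases key x (hw.le.trans h3.le) h4.le with rfl | rfl | rfl | rfl
    · exact (h3.trans hw.lt).false
    · exact h3.false
    · exact n1 h3.le
    · exact h4.false
  · intro x h3 h4
    rcases key x (hz.le.trans h3.le) h4.le with rfl | rfl | rfl | rfl
    · exact (h3.trans hz.lt).false
    · exact n2 h3.le
    · exact h3.false
    · exact h4.false

theorem aux_minus {P : Type*} [PartialOrder P] [Finite P] {k : ℕ} {a t n : P}
    (h : IsDkInterval k t n) (hat : a ⋖ t)
    (huniq : ∀ v, a ⋖ v → v = t) :
    IsDkMinusConvex (k + 1) (insert a (Set.Icc t n)) := by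
  obtain ⟨w, z, htn, ⟨hk, hw, hz, hwz, hzw, hS, hT, hN, hTc⟩, hNc⟩ := h
  have haw : a < w := hat.lt.trans_le hw.1
  have haz : a < z := hat.lt.trans_le hz.1
  have eT : {x ∈ insert a (Set.Icc t n) | x ≤ w ∧ x ≤ z} =
      insert a {x ∈ Set.Icc t n | x ≤ w ∧ x ≤ z} := by
    ext x
    constructor
    · rintro ⟨rfl | h1, h2⟩
      · exact Or.inl rfl
      · exact Or.inr ⟨h1, h2⟩
    · rintro (rfl | h1)
      · exact ⟨Or.inl rfl, haw.le, haz.le⟩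
      · exact ⟨Or.inr h1.1, h1.2⟩
  have eN : {x ∈ insert a (Set.Icc t n) | w ≤ x ∧ z ≤ x} =
      {x ∈ Set.Icc t n | w ≤ x ∧ z ≤ x} := by
    ext x
    constructor
    · rintro ⟨rfl | h1, h2⟩
      · exact absurd haw h2.1.not_gt
      · exact ⟨h1, h2⟩
    · rintro h1
      exact ⟨Or.inr h1.1, h1.2⟩
  refine ⟨?_, w, z, ⟨by omega, Or.inr hw, Or.inr hz, hwz, hzw, ?_, ?_, ?_, ?_⟩, ?_⟩
  · intro p hp q hq x hx hx'
    have hax : a ≤ x := by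
      rcases hp with rfl | hp
      · exact hx
      · exact (hat.le.trans hp.1).trans hx
    have hxn : x ≤ n := by
      rcases hq with rfl | hq
      · exact (hx'.trans hat.le).trans htn
      · exact hx'.trans hq.2
    rcases hax.eq_or_lt with rfl | hax
    · exact Or.inl rfl
    · obtain ⟨v, hv, hvx⟩ := exists_covBy_le_of_lt hax
      rw [huniq v hv] at hvx
      exact Or.inr ⟨hvx, hxn⟩
  · rintro x (rfl | h)
    · exact Or.inr (Or.inr (Or.inl ⟨haw.le, haz.le⟩))
    · exact hS x h
  · rw [eT]
    exact hT.insert (fun b hb _ => Or.inl (hat.le.trans hb.1.1))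
  · rw [eN]; exact hN
  · rw [eT, Set.ncard_insert_of_notMem, hTc]
    · omega
    · intro h
      exact absurd hat.lt h.1.1.not_gt
  · rw [eN, hNc]; omega

theorem aux_1b {P : Type*} [PartialOrder P] [Finite P] (hP : IsDComplete P)
    {k : ℕ} {a t n : P}
    (h : IsDkInterval k t n) (hat : a ⋖ t)
    (huniq : ∀ v, a ⋖ v → v = t) : ∃ b, IsDkInterval (k + 1) a b := by
  obtain ⟨b, -, h1, -⟩ := aux_complete hP (aux_minus h hat huniq) (a := a) (Or.inl rfl)
    (by rintro x (rfl | hx); exacts [le_rfl, hat.le.trans hx.1])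
  exact ⟨b, h1⟩

theorem aux_3a {P : Type*} [PartialOrder P] (hP : IsDComplete P) {w z b c : P}
    (hbc : b ≠ c) (h1 : w ⋖ b) (h2 : w ⋖ c) (h3 : z ⋖ b) (h4 : z ⋖ c) : w = z := by
  have := hP.2.2 3 3 _ _ (aux_minus3 hbc h1 h2) (aux_minus3 hbc h3 h4) w (by simp) z (by simp)
    (by rintro x (rfl | rfl | rfl); exacts [le_rfl, h1.le, h2.le])
    (by rintro x (rfl | rfl | rfl); exacts [le_rfl, h3.le, h4.le])
    (by
      ext x
      have e1 := h1.lt.ne'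
      have e2 := h2.lt.ne'
      have e3 := h3.lt.ne'
      have e4 := h4.lt.ne'
      simp only [Set.mem_diff, Set.mem_insert_iff, Set.mem_singleton_iff]
      grind)
  have hw : w ∈ ({z, b, c} : Set P) := by rw [← this]; simp
  rcases hw with h | h | h
  · exact h
  · exact absurd h h1.lt.ne
  · exact absurd h h2.lt.ne

theorem aux_3b {P : Type*} [PartialOrder P] [Finite P] (hP : IsDComplete P)
    {k : ℕ} {a a' t n : P}
    (h : IsDkInterval k t n) (hat : a ⋖ t)
    (huniq : ∀ v, a ⋖ v → v = t) (hat' : a' ⋖ t)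
    (huniq' : ∀ v, a' ⋖ v → v = t) : a = a' := by
  have n1 : a ∉ Set.Icc t n := fun h => absurd hat.lt h.1.not_gt
  have n2 : a' ∉ Set.Icc t n := fun h => absurd hat'.lt h.1.not_gt
  have := hP.2.2 _ _ _ _ (aux_minus h hat huniq) (aux_minus h hat' huniq') a (by simp) a' (by simp)
    (by rintro x (rfl | hx); exacts [le_rfl, hat.le.trans hx.1])
    (by rintro x (rfl | hx); exacts [le_rfl, hat'.le.trans hx.1])
    (by rw [Set.insert_diff_self_of_notMem n1, Set.insert_diff_self_of_notMem n2])
  have hw : a ∈ insert a' (Set.Icc t n) := by rw [← this]; simp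
  rcases hw with h | h
  · exact h
  · exact absurd h n1

theorem aux_A {P : Type*} [PartialOrder P] [Finite P] (hP : IsDComplete P) (x : P) :
    ∀ y z u v s : P, x ≠ y → y ≠ z → x ≠ z → u ⋖ x → u ⋖ y → v ⋖ y → v ⋖ z →
      s ⋖ x → s ⋖ z → False := by
  induction x using WellFoundedGT.induction with
  | ind x ih =>
  intro y z u v s hxy hyz hxz hux huy hvy hvz hsx hsz
  obtain ⟨p, hp, hp1, hp2, hp3⟩ := aux_1a hP hxy hux huy
  obtain ⟨q, hq, hq1, hq2, hq3⟩ := aux_1a hP hyz hvy hvz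
  obtain ⟨r, hr, hr1, hr2, hr3⟩ := aux_1a hP hxz hsx hsz
  have hzp : ¬ z ⋖ p := by
    intro h
    have := hP.2.1 u p ⟨3, hp⟩ z h
    rcases hp3 z this.1 this.2 with rfl | rfl | rfl | rfl
    · exact hvy.2 hvz.lt huy.lt
    · exact hxz rfl
    · exact hyz rfl
    · exact h.lt.false
  have hxq : ¬ x ⋖ q := by
    intro h
    have := hP.2.1 v q ⟨3, hq⟩ x h
    rcases hq3 x this.1 this.2 with rfl | rfl | rfl | rfl
    · exact huy.2 hux.lt hvy.lt
    · exact hxy rfl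
    · exact hxz rfl
    · exact h.lt.false
  exact ih p hp1.lt q r y z x (by rintro rfl; exact hzp hq2) (by rintro rfl; exact hxq hr1)
    (by rintro rfl; exact hzp hr2) hp2 hq1 hq2 hr2 hp1 hr1

theorem aux_B {P : Type*} [PartialOrder P] [Finite P] (hP : IsDComplete P) (k : ℕ) :
    ∀ a b d : P, IsDkInterval k a b → a ⋖ d → d ≤ b := by
  induction k with
  | zero =>
    intro a b d h
    rcases aux_peel h with ⟨h, -⟩ | ⟨h, -⟩ <;> omega
  | succ k ih =>
    intro a b d h had
    rcases aux_peel h with ⟨-, w, z, hwz, h1, h2, h3, h4, -⟩ | ⟨-, t, n, h1, h2, h3, -, -⟩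
    · by_contra hd
      exact aux_A hP w z d a a a hwz (by rintro rfl; exact hd h4.le)
        (by rintro rfl; exact hd h3.le) h1 h2 h2 had h1 had
    · by_cases htd : t = d
      · subst htd
        obtain ⟨_, _, h, _⟩ := h1
        exact h.trans h3.le
      · obtain ⟨e, -, he1, he2, -⟩ := aux_1a hP htd h2 had
        have := ih t n e h1 he1
        exact (he2.le.trans this).trans h3.le

theorem aux_E {P : Type*} [PartialOrder P] [Finite P] (hP : IsDComplete P) (k : ℕ) :
    ∀ (j : ℕ) (t n h : P), IsDkInterval k t n → IsDkInterval j n h →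
      (∀ u, n ⋖ u → ∀ v, v ⋖ u → v = n) → False := by
  induction k with
  | zero =>
    intro j t n h h1
    rcases aux_peel h1 with ⟨h, -⟩ | ⟨h, -⟩ <;> omega
  | succ k ih =>
    intro j t n h h1 h2 h3
    have huniq : ∀ w, w ⋖ n → ∀ v, w ⋖ v → v = n := by
      intro w hw v hv
      by_contra hne
      obtain ⟨u, -, hu1, hu2, -⟩ := aux_1a hP hne hv hw
      exact hne (h3 u hu2 v hu1)
    rcases aux_peel h1 with ⟨-, w, z, hwz, -, -, h5, h6, -⟩ | ⟨-, t', n', h4, h5, h6, h7, h8⟩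
    · exact hwz (aux_3b hP h2 h5 (huniq w h5) h6 (huniq z h6))
    · obtain ⟨h', hh⟩ := aux_1b hP h2 h6 (huniq n' h6)
      refine ih _ t' n' h' h4 hh ?_
      intro u hu v hv
      rw [huniq n' h6 u hu] at hv
      have := hP.2.1 t n ⟨_, h1⟩ v hv
      rcases h8 v this.1 this.2 with rfl | rfl | h9
      · exact absurd h6.lt (hv.2 (h5.lt.trans h7))
      · exact absurd hv.lt (lt_irrefl _)
      · exact (h9.2.eq_or_lt).resolve_right (fun h => hv.2 h h6.lt)

theorem aux_C {P : Type*} [PartialOrder P] [Finite P] (hP : IsDComplete P) (k : ℕ) :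
    ∀ (k' : ℕ) (a b b' : P), IsDkInterval k a b → IsDkInterval k' a b' → b = b' := by
  induction k with
  | zero =>
    intro j t n h h1
    rcases aux_peel h1 with ⟨h, -⟩ | ⟨h, -⟩ <;> omega
  | succ k ih =>
    intro k' a b b' h h'
    -- a unique atom when peeling
    have uniqAtom : ∀ (j : ℕ) (c t n : P), IsDkInterval j a c → a ⋖ t → n ⋖ c → t < n →
        (∀ x, a ≤ x → x ≤ c → x = a ∨ x = c ∨ (t ≤ x ∧ x ≤ n)) → ∀ v, a ⋖ v → v = t := by
      intro j c t n hj hat hnc htn hall v hv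
      have htv : t ≤ v := by
        rcases hall v hv.le (aux_B hP j a c v hj hv) with rfl | rfl | h
        · exact absurd hv.lt (lt_irrefl _)
        · exact (htn.trans hnc.lt).le
        · exact h.1
      exact (htv.eq_or_lt.resolve_right (fun h => hv.2 hat.lt h)).symm
    have uniqCo : ∀ (j : ℕ) (c t n : P), IsDkInterval j a c → a ⋖ t → n ⋖ c → t < n →
        (∀ x, a ≤ x → x ≤ c → x = a ∨ x = c ∨ (t ≤ x ∧ x ≤ n)) → ∀ v, v ⋖ c → v = n := by
      intro j c t n hj hat hnc htn hall v hv
      have hvn : v ≤ n := by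
        have := hP.2.1 a c ⟨j, hj⟩ v hv
        rcases hall v this.1 this.2 with rfl | rfl | h
        · exact (hat.lt.trans htn).le
        · exact absurd hv.lt (lt_irrefl _)
        · exact h.2
      exact (hvn.eq_or_lt.resolve_right (fun h => hv.2 h hnc.lt))
    rcases aux_peel h with ⟨-, w, z, hwz, h1, h2, h3, h4, -⟩ | ⟨-, t, n, h1, h2, h3, h4, h5⟩ <;>
    rcases aux_peel h' with ⟨-, w', z', hwz', h1', h2', h3', h4', h5'⟩ |
      ⟨-, t', n', h1', h2', h3', h4', h5'⟩
    · by_contra hne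
      have side : ∀ v, a ⋖ v → v ⋖ b' := by
        intro v hv
        rcases h5' v hv.le (aux_B hP _ a b' v h' hv) with rfl | rfl | rfl | rfl
        · exact absurd hv.lt (lt_irrefl _)
        · exact h3'
        · exact h4'
        · exact absurd h3'.lt (hv.2 h1'.lt)
      exact hwz (aux_3a hP hne h3 (side w h1) h4 (side z h2))
    · have := uniqAtom _ _ _ _ h' h2' h3' h4' h5'
      exact absurd ((this w h1).trans (this z h2).symm) hwz
    · have := uniqAtom _ _ _ _ h h2 h3 h4 h5
      exact absurd ((this w' h1').trans (this z' h2').symm) hwz'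
    · have e := uniqAtom _ _ _ _ h h2 h3 h4 h5 t' h2'
      subst e
      have e := ih _ _ _ _ h1 h1'
      subst e
      by_contra hne
      obtain ⟨g, hg, -, -, hg4⟩ := aux_1a hP hne h3 h3'
      refine aux_E hP _ _ _ _ _ h1 hg ?_
      intro u hu v hv
      have hub : u = b ∨ u = b' := by
        by_contra hcon
        push Not at hcon
        exact aux_A hP b b' u n n n hne (Ne.symm hcon.2) (Ne.symm hcon.1) h3 h3' h3' hu h3 hu
      rcases hub with rfl | rfl
      · exact uniqCo _ _ _ _ h h2 h3 h4 h5 v hv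
      · exact uniqCo _ _ _ _ h' h2' h3' h4' h5' v hv

theorem aux_reach {P : Type*} [PartialOrder P] [Finite P] (hP : IsDComplete P) (S : Set P)
    (hS : IsUpperSet S) {x y : P} (h : DiagRel x y) :
    (∃ s ∈ S, Relation.ReflTransGen (fun x y => IsDInterval x y) x s) ↔
    (∃ s ∈ S, Relation.ReflTransGen (fun x y => IsDInterval x y) y s) := by
  induction h with
  | rel x y h =>
    constructor
    · rintro ⟨s, hs, hr⟩
      rcases hr.cases_head with rfl | ⟨c, hc, hr⟩
      · obtain ⟨_, _, _, h, _⟩ := h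
        exact ⟨y, hS h hs, .refl⟩
      · obtain ⟨k, h⟩ := h
        obtain ⟨k', hc⟩ := hc
        have := aux_C hP k k' x y c h hc
        subst this
        exact ⟨s, hs, hr⟩
    · rintro ⟨s, hs, hr⟩
      exact ⟨s, hs, hr.head h⟩
  | refl x => rfl
  | symm x y _ ih => exact ih.symm
  | trans x y z _ _ h1 h2 => exact h1.trans h2

theorem aux_main {P : Type*} [PartialOrder P] [Finite P] (hP : IsDComplete P) (S : Set P)
    (hS : IsUpperSet S) (c : P) : ∀ c0 d0 d : P, c0 ∈ S → d0 ∈ S → DiagRel c0 c → DiagRel d0 d →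
      c ⋖ d → ∃ c' d' : P, c' ∈ S ∧ d' ∈ S ∧ DiagRel c0 c' ∧ DiagRel d0 d' ∧
        (c' ⋖ d' ∨ d' ⋖ c') := by
  induction c using WellFoundedGT.induction with
  | ind c ih =>
  intro c0 d0 d hc0 hd0 hc hd hcd
  by_cases hcS : c ∈ S
  · exact ⟨c, d, hcS, hS hcd.le hcS, hc, hd, Or.inl hcd⟩
  obtain ⟨s, hs, hr⟩ := (aux_reach hP S hS hc).1 ⟨c0, hc0, .refl⟩
  rcases hr.cases_head with rfl | ⟨b, ⟨k, hb⟩, -⟩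
  · exact absurd hs hcS
  have hcb : DiagRel c0 b := hc.trans _ _ _ (.rel _ _ ⟨k, hb⟩)
  have hdb := aux_B hP k c b d hb hcd
  rcases aux_peel hb with ⟨-, w, z, hwz, h1, h2, h3, h4, h5⟩ | ⟨-, t, n, h1, h2, h3, h4, h5⟩
  · have hdb' : d ⋖ b := by
      rcases h5 d hcd.le hdb with rfl | rfl | rfl | rfl
      · exact absurd hcd.lt (lt_irrefl _)
      · exact h3
      · exact h4
      · exact absurd h3.lt (hcd.2 h1.lt)
    obtain ⟨p, q, hp, hq, hdp, hcq, hpq⟩ := ih d hcd.lt d0 c0 b hd0 hc0 hd hcb hdb'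
    exact ⟨q, p, hq, hp, hcq, hdp, hpq.symm⟩
  · have htd : t = d := by
      have : t ≤ d := by
        rcases h5 d hcd.le hdb with rfl | rfl | h
        · exact absurd hcd.lt (lt_irrefl _)
        · exact (h4.trans h3.lt).le
        · exact h.1
      exact this.eq_or_lt.resolve_right (fun h => hcd.2 h2.lt h)
    subst htd
    have hdn : DiagRel d0 n := hd.trans _ _ _ (.rel _ _ ⟨_, h1⟩)
    obtain ⟨p, q, hp, hq, hdp, hcq, hpq⟩ := ih n (h2.lt.trans h4) d0 c0 b hd0 hc0 hdn hcb h3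
    exact ⟨q, p, hq, hp, hcq, hdp, hpq.symm⟩

theorem aux_cov {P : Type*} [PartialOrder P] (S : Set P) (hS : IsUpperSet S) (c d : S) :
    c ⋖ d ↔ (c : P) ⋖ (d : P) := by
  constructor
  · rintro ⟨h1, h2⟩
    exact ⟨h1, fun x hx hx' => h2 (c := ⟨x, hS hx.le c.2⟩) hx hx'⟩
  · rintro ⟨h1, h2⟩
    exact ⟨h1, fun x hx hx' => h2 hx hx'⟩

/-- For an upper set `S` of a d-complete poset `P` and two diagonals of `P`
meeting `S` (with representatives `c0, d0 ∈ S`), the restricted diagonals are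
adjacent in `S` if and only if the diagonals are adjacent in `P`. -/
theorem upperSet_diagonal_adjacent_iff {P : Type*} [PartialOrder P] [Fintype P]
    (hP : IsDComplete P) (S : Set P) (hS : IsUpperSet S)
    (c0 d0 : P) (hc0 : c0 ∈ S) (hd0 : d0 ∈ S) :
    (∃ c d : S, DiagRel c0 (c : P) ∧ DiagRel d0 (d : P) ∧ (c ⋖ d ∨ d ⋖ c)) ↔
      (∃ c d : P, DiagRel c0 c ∧ DiagRel d0 d ∧ (c ⋖ d ∨ d ⋖ c)) := by
  constructor
  · rintro ⟨c, d, h1, h2, h3⟩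
    refine ⟨c, d, h1, h2, ?_⟩
    rwa [aux_cov S hS, aux_cov S hS] at h3
  · rintro ⟨c, d, h1, h2, h3⟩
    have : ∃ c' d' : P, c' ∈ S ∧ d' ∈ S ∧ DiagRel c0 c' ∧ DiagRel d0 d' ∧
        (c' ⋖ d' ∨ d' ⋖ c') := by
      rcases h3 with h3 | h3
      · exact aux_main hP S hS c c0 d0 d hc0 hd0 h1 h2 h3
      · obtain ⟨p, q, hp, hq, h4, h5, h6⟩ := aux_main hP S hS d d0 c0 c hd0 hc0 h2 h1 h3
        exact ⟨q, p, hq, hp, h5, h4, h6.symm⟩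
    obtain ⟨p, q, hp, hq, h4, h5, h6⟩ := this
    refine ⟨⟨p, hp⟩, ⟨q, hq⟩, h4, h5, ?_⟩
    rwa [aux_cov S hS, aux_cov S hS]
end

section
/- Every hook vector of a d-complete poset has nonnegative entries: for every element p of a d-complete poset P and every diagonal D, the D-coordinate h_P^{(D)}(p) of the hook vector of p is a nonnegative integer. -/
variable {P : Type*} [PartialOrder P]

set_option linter.unusedSectionVars false
namespace DCP

inductive DI {P : Type*} [PartialOrder P] : ℕ → P → P → P → P → Prop
  | base {a b w z : P} : a ⋖ w → a ⋖ z → w ≠ z → w ⋖ b → z ⋖ b →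
      (∀ x, a ≤ x → x ≤ b → x = a ∨ x = w ∨ x = z ∨ x = b) → DI 0 a b w z
  | step {n : ℕ} {t q a b w z : P} : DI n t q w z → a ⋖ t → q ⋖ b →
      (∀ x, a ≤ x → x ≤ b → x = a ∨ x = b ∨ (t ≤ x ∧ x ≤ q)) → DI (n+1) a b w z

variable {P : Type*} [PartialOrder P]

theorem not_le_of_common_lower {a w z : P} (h1 : a ⋖ w) (h2 : a ⋖ z) (h : w ≠ z) : ¬ w ≤ z :=
  fun hl => h2.2 h1.1 (lt_of_le_of_ne hl h)

theorem not_le_of_common_upper {b w z : P} (h1 : w ⋖ b) (h2 : z ⋖ b) (h : w ≠ z) : ¬ w ≤ z :=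
  fun hl => h1.2 (lt_of_le_of_ne hl h) h2.1

theorem DI.facts {n : ℕ} {a b w z : P} (h : DI n a b w z) :
    a < w ∧ a < z ∧ w < b ∧ z < b ∧ ¬ w ≤ z ∧ ¬ z ≤ w := by
  induction h with
  | base h1 h2 h3 h4 h5 _ =>
    exact ⟨h1.1, h2.1, h4.1, h5.1, not_le_of_common_lower h1 h2 h3,
      not_le_of_common_lower h2 h1 h3.symm⟩
  | step _ h1 h2 _ ih =>
    obtain ⟨i1, i2, i3, i4, i5, i6⟩ := ih
    exact ⟨h1.1.trans i1, h1.1.trans i2, i3.trans h2.1, i4.trans h2.1, i5, i6⟩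

theorem DI.lt {n : ℕ} {a b w z : P} (h : DI n a b w z) : a < b := h.facts.1.trans h.facts.2.2.1

theorem DI.symm {n : ℕ} {a b w z : P} (h : DI n a b w z) : DI n a b z w := by
  induction h with
  | base h1 h2 h3 h4 h5 h6 =>
    refine .base h2 h1 h3.symm h5 h4 ?_
    intro x hx hx'
    rcases h6 x hx hx' with h | h | h | h <;> simp [h]
  | step _ h1 h2 h3 ih => exact .step ih h1 h2 h3

section fin
variable [Finite P]

theorem struct_insert_bot {k : ℕ} {S : Set P} {w z a : P} (h : DkStruct k S w z) (ha : a ∉ S)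
    (hl : ∀ x ∈ S, a ≤ x) : DkStruct (k+1) (insert a S) w z ∧
      {x ∈ insert a S | w ≤ x ∧ z ≤ x} = {x ∈ S | w ≤ x ∧ z ≤ x} := by
  obtain ⟨h0, h1, h2, h3, h4, h5, h6, h7, h8⟩ := h
  have haw := hl w h1
  have haz := hl z h2
  have e1 : {x ∈ insert a S | x ≤ w ∧ x ≤ z} = insert a {x ∈ S | x ≤ w ∧ x ≤ z} := by
    ext x
    simp only [Set.mem_ofPred_eq, Set.mem_insert_iff]
    constructor
    · rintro ⟨rfl | h, h'⟩
      · exact Or.inl rfl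
      · exact Or.inr ⟨h, h'⟩
    · rintro (rfl | ⟨h, h'⟩)
      · exact ⟨Or.inl rfl, haw, haz⟩
      · exact ⟨Or.inr h, h'⟩
  have e2 : {x ∈ insert a S | w ≤ x ∧ z ≤ x} = {x ∈ S | w ≤ x ∧ z ≤ x} := by
    ext x
    simp only [Set.mem_ofPred_eq, Set.mem_insert_iff]
    constructor
    · rintro ⟨rfl | h, h'⟩
      · exact absurd (h'.1.trans haz) h3
      · exact ⟨h, h'⟩
    · rintro ⟨h, h'⟩
      exact ⟨Or.inr h, h'⟩
  refine ⟨⟨by omega, Or.inr h1, Or.inr h2, h3, h4, ?_, ?_, ?_, ?_⟩, e2⟩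
  · rintro x (rfl | hx)
    · exact Or.inr (Or.inr (Or.inl ⟨haw, haz⟩))
    · exact h5 x hx
  · rw [e1]
    refine h6.insert ?_
    intro x hx _
    exact Or.inl (hl x hx.1)
  · rw [e2]; exact h7
  · rw [e1, Set.ncard_insert_of_notMem (fun hh => ha hh.1) (Set.toFinite _), h8]
    omega

theorem struct_insert_top {k : ℕ} {S : Set P} {w z b : P} (h : DkStruct k S w z) (hb : b ∉ S)
    (hl : ∀ x ∈ S, x ≤ b) : DkStruct k (insert b S) w z ∧
      {x ∈ insert b S | w ≤ x ∧ z ≤ x}.ncard = {x ∈ S | w ≤ x ∧ z ≤ x}.ncard + 1 := by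
  obtain ⟨h0, h1, h2, h3, h4, h5, h6, h7, h8⟩ := h
  have haw := hl w h1
  have haz := hl z h2
  have e1 : {x ∈ insert b S | w ≤ x ∧ z ≤ x} = insert b {x ∈ S | w ≤ x ∧ z ≤ x} := by
    ext x
    simp only [Set.mem_ofPred_eq, Set.mem_insert_iff]
    constructor
    · rintro ⟨rfl | h, h'⟩
      · exact Or.inl rfl
      · exact Or.inr ⟨h, h'⟩
    · rintro (rfl | ⟨h, h'⟩)
      · exact ⟨Or.inl rfl, haw, haz⟩
      · exact ⟨Or.inr h, h'⟩
  have e2 : {x ∈ insert b S | x ≤ w ∧ x ≤ z} = {x ∈ S | x ≤ w ∧ x ≤ z} := by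
    ext x
    simp only [Set.mem_ofPred_eq, Set.mem_insert_iff]
    constructor
    · rintro ⟨rfl | h, h'⟩
      · exact absurd (haz.trans h'.1) h4
      · exact ⟨h, h'⟩
    · rintro ⟨h, h'⟩
      exact ⟨Or.inr h, h'⟩
  refine ⟨⟨h0, Or.inr h1, Or.inr h2, h3, h4, ?_, ?_, ?_, ?_⟩, ?_⟩
  · rintro x (rfl | hx)
    · exact Or.inr (Or.inr (Or.inr ⟨haw, haz⟩))
    · exact h5 x hx
  · rw [e2]; exact h6
  · rw [e1]
    refine h7.insert ?_
    intro x hx _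
    exact Or.inr (hl x hx.1)
  · rw [e2]; exact h8
  · rw [e1, Set.ncard_insert_of_notMem (fun hh => hb hh.1) (Set.toFinite _)]

theorem struct_three {a w z : P} (h1 : a ⋖ w) (h2 : a ⋖ z) (h3 : w ≠ z) :
    DkStruct 3 ({a, w, z} : Set P) w z ∧
      {x ∈ ({a, w, z} : Set P) | w ≤ x ∧ z ≤ x}.ncard = 0 := by
  have n1 := not_le_of_common_lower h1 h2 h3
  have n2 := not_le_of_common_lower h2 h1 h3.symm
  have e1 : {x ∈ ({a, w, z} : Set P) | x ≤ w ∧ x ≤ z} = {a} := by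
    ext x
    simp only [Set.mem_ofPred_eq, Set.mem_insert_iff, Set.mem_singleton_iff]
    constructor
    · rintro ⟨rfl | rfl | rfl, h4, h5⟩
      · rfl
      · exact absurd h5 n1
      · exact absurd h4 n2
    · rintro rfl
      exact ⟨Or.inl rfl, h1.1.le, h2.1.le⟩
  have e2 : {x ∈ ({a, w, z} : Set P) | w ≤ x ∧ z ≤ x} = ∅ := by
    ext x
    simp only [Set.mem_ofPred_eq, Set.mem_insert_iff, Set.mem_singleton_iff,
      Set.mem_empty_iff_false, iff_false]
    rintro ⟨rfl | rfl | rfl, h4, h5⟩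
    · exact absurd h1.1 h4.not_gt
    · exact absurd h5 n2
    · exact absurd h4 n1
  refine ⟨⟨le_rfl, by simp, by simp, n1, n2, ?_, ?_, ?_, ?_⟩, ?_⟩
  · simp only [Set.mem_insert_iff, Set.mem_singleton_iff]
    rintro x (rfl | rfl | rfl)
    · exact Or.inr (Or.inr (Or.inl ⟨h1.1.le, h2.1.le⟩))
    · simp
    · simp
  · rw [e1]; simp
  · rw [e2]; simp
  · rw [e1]; simp
  · rw [e2]; simp

theorem three_convex {a w z : P} (h1 : a ⋖ w) (h2 : a ⋖ z) (h3 : w ≠ z) :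
    IsDkMinusConvex 3 ({a, w, z} : Set P) := by
  obtain ⟨s1, s2⟩ := struct_three h1 h2 h3
  have n1 := not_le_of_common_lower h1 h2 h3
  have n2 := not_le_of_common_lower h2 h1 h3.symm
  refine ⟨?_, w, z, s1, s2⟩
  simp only [IsConvexSet, Set.mem_insert_iff, Set.mem_singleton_iff]
  have key : ∀ x, a ≤ x → (x ≤ w ∨ x ≤ z) → x = a ∨ x = w ∨ x = z := by
    rintro x hx (h | h)
    · rcases h1.eq_or_eq hx h with h | h <;> simp [h]
    · rcases h2.eq_or_eq hx h with h | h <;> simp [h]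
  intro u hu v hv x hx hx'
  have hax : a ≤ x := by
    rcases hu with rfl | rfl | rfl
    · exact hx
    · exact h1.1.le.trans hx
    · exact h2.1.le.trans hx
  apply key x hax
  rcases hv with rfl | rfl | rfl
  · exact Or.inl (hx'.trans h1.1.le)
  · exact Or.inl hx'
  · exact Or.inr hx'

theorem DI.toWith {n : ℕ} {a b w z : P} (h : DI n a b w z) : IsDkIntervalWith (n+3) a b w z := by
  induction h with
  | @base a b w z h1 h2 h3 h4 h5 h6 =>
    obtain ⟨s1, s2⟩ := struct_three h1 h2 h3
    have e : Set.Icc a b = insert b ({a, w, z} : Set P) := by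
      ext x
      simp only [Set.mem_Icc, Set.mem_insert_iff, Set.mem_singleton_iff]
      constructor
      · rintro ⟨h, h'⟩
        rcases h6 x h h' with h | h | h | h <;> simp [h]
      · rintro (rfl | rfl | rfl | rfl)
        · exact ⟨(h1.1.trans h4.1).le, le_rfl⟩
        · exact ⟨le_rfl, (h1.1.trans h4.1).le⟩
        · exact ⟨h1.1.le, h4.1.le⟩
        · exact ⟨h2.1.le, h5.1.le⟩
    have := struct_insert_top (b := b) s1 (by
      simp only [Set.mem_insert_iff, Set.mem_singleton_iff]
      rintro (rfl | rfl | rfl)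
      · exact (h1.1.trans h4.1).ne rfl
      · exact h4.1.ne rfl
      · exact h5.1.ne rfl) (by
      simp only [Set.mem_insert_iff, Set.mem_singleton_iff]
      rintro x (rfl | rfl | rfl)
      · exact (h1.1.trans h4.1).le
      · exact h4.1.le
      · exact h5.1.le)
    rw [← e, s2] at this
    exact ⟨(h1.1.trans h4.1).le, this.1, this.2⟩
  | @step n t q a b w z h h1 h2 h3 ih =>
    obtain ⟨i1, i2, i3⟩ := ih
    have s := struct_insert_bot (a := a) i2 (fun hh => h1.1.not_ge hh.1)
      (fun x hx => h1.1.le.trans hx.1)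
    have e : Set.Icc a b = insert b (insert a (Set.Icc t q)) := by
      ext x
      simp only [Set.mem_Icc, Set.mem_insert_iff]
      constructor
      · rintro ⟨h, h'⟩
        rcases h3 x h h' with h | h | h
        · exact Or.inr (Or.inl h)
        · exact Or.inl h
        · exact Or.inr (Or.inr h)
      · have hab := (h1.1.trans_le (i1.trans h2.1.le)).le
        rintro (rfl | rfl | ⟨h, h'⟩)
        · exact ⟨hab, le_rfl⟩
        · exact ⟨le_rfl, hab⟩
        · exact ⟨h1.1.le.trans h, h'.trans h2.1.le⟩
    have := struct_insert_top (b := b) s.1 (by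
      rintro (rfl | h)
      · exact (h1.1.trans_le (i1.trans h2.1.le)).ne rfl
      · exact h2.1.not_ge h.2) (by
      rintro x (rfl | h)
      · exact (h1.1.trans_le (i1.trans h2.1.le)).le
      · exact h.2.trans h2.1.le)
    rw [← e, s.2, i3] at this
    exact ⟨(h1.1.trans_le (i1.trans h2.1.le)).le, this.1, this.2⟩

theorem DI.ofWith : ∀ {n : ℕ} {a b w z : P}, IsDkIntervalWith (n+3) a b w z → DI n a b w z := by
  intro n
  induction n with
  | zero =>
    rintro a b w z ⟨hab, ⟨_, hw, hz, nwz, nzw, h5, h6, h7, h8⟩, h9⟩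
    obtain ⟨t, ht⟩ := Set.ncard_eq_one.1 h8
    obtain ⟨q, hq⟩ := Set.ncard_eq_one.1 h9
    have ha : a = t := by
      have : a ∈ ({t} : Set P) := ht ▸ ⟨⟨le_rfl, hab⟩, hw.1, hz.1⟩
      exact this
    have hb : b = q := by
      have : b ∈ ({q} : Set P) := hq ▸ ⟨⟨hab, le_rfl⟩, hw.2, hz.2⟩
      exact this
    subst ha hb
    have key : ∀ x, a ≤ x → x ≤ b → x = a ∨ x = w ∨ x = z ∨ x = b := by
      intro x h1 h2
      rcases h5 x ⟨h1, h2⟩ with h | h | h | h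
      · simp [h]
      · simp [h]
      · have : x ∈ ({a} : Set P) := ht ▸ ⟨⟨h1, h2⟩, h⟩
        exact Or.inl this
      · have : x ∈ ({b} : Set P) := hq ▸ ⟨⟨h1, h2⟩, h⟩
        exact Or.inr (Or.inr (Or.inr this))
    have aw : a < w := lt_of_le_of_ne hw.1 (by rintro rfl; exact nwz hz.1)
    have az : a < z := lt_of_le_of_ne hz.1 (by rintro rfl; exact nzw hw.1)
    have wb : w < b := lt_of_le_of_ne hw.2 (by rintro rfl; exact nzw hz.2)
    have zb : z < b := lt_of_le_of_ne hz.2 (by rintro rfl; exact nwz hw.2)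
    refine .base ⟨aw, ?_⟩ ⟨az, ?_⟩ (fun h => nwz h.le) ⟨wb, ?_⟩ ⟨zb, ?_⟩ key
    · intro x h1 h2
      rcases key x h1.le (h2.le.trans wb.le) with rfl | rfl | rfl | rfl
      · exact h1.ne rfl
      · exact h2.ne rfl
      · exact nzw h2.le
      · exact h2.not_gt wb
    · intro x h1 h2
      rcases key x h1.le (h2.le.trans zb.le) with rfl | rfl | rfl | rfl
      · exact h1.ne rfl
      · exact nwz h2.le
      · exact h2.ne rfl
      · exact h2.not_gt zb
    · intro x h1 h2
      rcases key x (aw.le.trans h1.le) h2.le with rfl | rfl | rfl | rfl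
      · exact h1.not_gt aw
      · exact h1.ne rfl
      · exact nwz h1.le
      · exact h2.ne rfl
    · intro x h1 h2
      rcases key x (az.le.trans h1.le) h2.le with rfl | rfl | rfl | rfl
      · exact h1.not_gt az
      · exact nzw h1.le
      · exact h1.ne rfl
      · exact h2.ne rfl
  | succ n ih =>
    rintro a b w z ⟨hab, ⟨_, hw, hz, nwz, nzw, h5, h6, h7, h8⟩, h9⟩
    set T := {x ∈ Set.Icc a b | x ≤ w ∧ x ≤ z} with hT
    set N := {x ∈ Set.Icc a b | w ≤ x ∧ z ≤ x} with hN
    have haT : a ∈ T := ⟨⟨le_rfl, hab⟩, hw.1, hz.1⟩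
    have hbN : b ∈ N := ⟨⟨hab, le_rfl⟩, hw.2, hz.2⟩
    have c1 : (T \ {a}).ncard = n + 1 := by
      rw [Set.ncard_sdiff_singleton_of_mem haT, h8]; omega
    have c2 : (N \ {b}).ncard = n + 1 := by
      rw [Set.ncard_sdiff_singleton_of_mem hbN, h9]; omega
    have ne1 : (T \ {a}).Nonempty := by
      apply Set.nonempty_of_ncard_ne_zero; omega
    have ne2 : (N \ {b}).Nonempty := by
      apply Set.nonempty_of_ncard_ne_zero; omega
    obtain ⟨t, ht⟩ := (Set.toFinite (T \ {a})).exists_minimal ne1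
    obtain ⟨q, hq⟩ := (Set.toFinite (N \ {b})).exists_maximal ne2
    have tmin : ∀ x ∈ T, x ≠ a → t ≤ x := by
      intro x hx hxa
      rcases h6.total ht.1.1 hx with h | h
      · exact h
      · exact ht.2 ⟨hx, hxa⟩ h
    have qmax : ∀ x ∈ N, x ≠ b → x ≤ q := by
      intro x hx hxa
      rcases h7.total hq.1.1 hx with h | h
      · exact hq.2 ⟨hx, hxa⟩ h
      · exact h
    have tw : t ≤ w := ht.1.1.2.1
    have tz : t ≤ z := ht.1.1.2.2
    have wq : w ≤ q := hq.1.1.2.1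
    have zq : z ≤ q := hq.1.1.2.2
    have hat : a < t := lt_of_le_of_ne ht.1.1.1.1 (Ne.symm ht.1.2)
    have hqb : q < b := lt_of_le_of_ne hq.1.1.1.2 hq.1.2
    have eT : {x ∈ Set.Icc t q | x ≤ w ∧ x ≤ z} = T \ {a} := by
      ext x
      constructor
      · rintro ⟨⟨h1, h2⟩, h3⟩
        exact ⟨⟨⟨hat.le.trans h1, h2.trans hqb.le⟩, h3⟩, fun h => (hat.trans_le h1).ne' h⟩
      · rintro ⟨h1, h2⟩
        exact ⟨⟨tmin x h1 h2, h1.2.1.trans wq⟩, h1.2⟩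
    have eN : {x ∈ Set.Icc t q | w ≤ x ∧ z ≤ x} = N \ {b} := by
      ext x
      constructor
      · rintro ⟨⟨h1, h2⟩, h3⟩
        exact ⟨⟨⟨hat.le.trans h1, h2.trans hqb.le⟩, h3⟩, fun h => (h2.trans_lt hqb).ne h⟩
      · rintro ⟨h1, h2⟩
        exact ⟨⟨tw.trans h1.2.1, qmax x h1 h2⟩, h1.2⟩
    have key : ∀ x, a ≤ x → x ≤ b → x = a ∨ x = b ∨ (t ≤ x ∧ x ≤ q) := by
      intro x h1 h2
      by_cases hxa : x = a
      · exact Or.inl hxa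
      by_cases hxb : x = b
      · exact Or.inr (Or.inl hxb)
      refine Or.inr (Or.inr ?_)
      rcases h5 x ⟨h1, h2⟩ with h | h | h | h
      · subst h; exact ⟨tw, wq⟩
      · subst h; exact ⟨tz, zq⟩
      · exact ⟨tmin x ⟨⟨h1, h2⟩, h⟩ hxa, h.1.trans wq⟩
      · exact ⟨tw.trans h.1, qmax x ⟨⟨h1, h2⟩, h⟩ hxb⟩
    refine .step (ih ?_) ⟨hat, ?_⟩ ⟨hqb, ?_⟩ key
    · refine ⟨tw.trans wq, ⟨by omega, ⟨tw, wq⟩, ⟨tz, zq⟩, nwz, nzw, ?_, ?_, ?_, ?_⟩, ?_⟩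
      · intro x hx
        exact h5 x ⟨hat.le.trans hx.1, hx.2.trans hqb.le⟩
      · rw [eT]; exact h6.mono Set.sdiff_subset
      · rw [eN]; exact h7.mono Set.sdiff_subset
      · rw [eT, c1]; omega
      · rw [eN, c2]; omega
    · intro x h1 h2
      exact h2.not_ge (tmin x ⟨⟨h1.le, (h2.trans_le (tw.trans hw.2)).le⟩,
        h2.le.trans tw, h2.le.trans tz⟩ h1.ne')
    · intro x h1 h2
      exact h1.not_ge (qmax x ⟨⟨(hw.1.trans wq).trans h1.le, h2.le⟩,
        wq.trans h1.le, zq.trans h1.le⟩ h2.ne)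

def Up (x y : P) : Prop := ∃ n w z, DI n x y w z

theorem up_iff {x y : P} : IsDInterval x y ↔ Up x y := by
  constructor
  · rintro ⟨k, w, z, h⟩
    have h3 : 3 ≤ k := h.2.1.1
    obtain ⟨n, rfl⟩ := Nat.exists_eq_add_of_le' h3
    exact ⟨n, w, z, DI.ofWith h⟩
  · rintro ⟨n, w, z, h⟩
    exact ⟨n+3, w, z, h.toWith⟩

theorem ax1a (hP : IsDComplete P) {x w z : P} (h1 : x ⋖ w) (h2 : x ⋖ z) (h3 : w ≠ z) :
    ∃ b, DI 0 x b w z := by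
  obtain ⟨b, hb, a, _, he⟩ := hP.1 3 _ (three_convex h1 h2 h3)
  have n1 := not_le_of_common_lower h1 h2 h3
  have n2 := not_le_of_common_lower h2 h1 h3.symm
  have m : ∀ y, (a ≤ y ∧ y ≤ b) ↔ (y = b ∨ y = x ∨ y = w ∨ y = z) := by
    intro y
    have := Set.ext_iff.1 he y
    simpa using this
  simp only [Set.mem_insert_iff, Set.mem_singleton_iff, not_or] at hb
  have hx := (m x).2 (by simp)
  have hw := (m w).2 (by simp)
  have hz := (m z).2 (by simp)
  have hax : a = x := by
    rcases (m a).1 ⟨le_rfl, hx.1.trans hx.2⟩ with h | h | h | h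
    · exact absurd (le_antisymm (h ▸ hx.1) hx.2) hb.1
    · exact h
    · exact absurd (h ▸ hx.1) h1.1.not_ge
    · exact absurd (h ▸ hx.1) h2.1.not_ge
  subst hax
  have wb : w < b := lt_of_le_of_ne hw.2 (Ne.symm hb.2.1)
  have zb : z < b := lt_of_le_of_ne hz.2 (Ne.symm hb.2.2)
  refine ⟨b, .base h1 h2 h3 ⟨wb, ?_⟩ ⟨zb, ?_⟩ ?_⟩
  · intro y hy hy'
    rcases (m y).1 ⟨h1.1.le.trans hy.le, hy'.le⟩ with rfl | rfl | rfl | rfl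
    · exact hy'.ne rfl
    · exact hy.not_gt h1.1
    · exact hy.ne rfl
    · exact n1 hy.le
  · intro y hy hy'
    rcases (m y).1 ⟨h2.1.le.trans hy.le, hy'.le⟩ with rfl | rfl | rfl | rfl
    · exact hy'.ne rfl
    · exact hy.not_gt h2.1
    · exact n2 hy.le
    · exact hy.ne rfl
  · intro y hy hy'
    rcases (m y).1 ⟨hy, hy'⟩ with h | h | h | h <;> simp [h]

theorem convex_bot {n : ℕ} {t q w z a : P} (h : DI n t q w z) (ha : a ⋖ t)
    (hI : ∀ x, a ≤ x → x ≤ q → x = a ∨ t ≤ x) :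
    IsDkMinusConvex (n+4) (Set.Icc a q) ∧ Set.Icc a q = insert a (Set.Icc t q) := by
  have e : Set.Icc a q = insert a (Set.Icc t q) := by
    ext x
    simp only [Set.mem_Icc, Set.mem_insert_iff]
    constructor
    · rintro ⟨h1, h2⟩
      rcases hI x h1 h2 with h | h
      · exact Or.inl h
      · exact Or.inr ⟨h, h2⟩
    · rintro (rfl | ⟨h1, h2⟩)
      · exact ⟨le_rfl, ha.1.le.trans h.lt.le⟩
      · exact ⟨ha.1.le.trans h1, h2⟩
  obtain ⟨_, s1, s2⟩ := h.toWith
  have := struct_insert_bot (a := a) s1 (fun hh => ha.1.not_ge hh.1)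
      (fun x hx => ha.1.le.trans hx.1)
  refine ⟨⟨?_, w, z, ?_, ?_⟩, e⟩
  · intro u hu v hv x h1 h2
    exact ⟨hu.1.trans h1, h2.trans hv.2⟩
  · rw [e]; exact this.1
  · rw [e, this.2, s2]; omega

theorem ax1b (hP : IsDComplete P) {n : ℕ} {t q w z a : P} (h : DI n t q w z) (ha : a ⋖ t)
    (hI : ∀ x, a ≤ x → x ≤ q → x = a ∨ t ≤ x) : ∃ b, DI (n+1) a b w z := by
  obtain ⟨b, hb, a', _, he⟩ := hP.1 _ _ (convex_bot h ha hI).1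
  have m : ∀ y, (a' ≤ y ∧ y ≤ b) ↔ (y = b ∨ (a ≤ y ∧ y ≤ q)) := by
    intro y
    have := Set.ext_iff.1 he y
    simpa using this
  have haq : a ≤ q := ha.1.le.trans h.lt.le
  have hx := (m a).2 (Or.inr ⟨le_rfl, haq⟩)
  have hq := (m q).2 (Or.inr ⟨haq, le_rfl⟩)
  have hax : a' = a := by
    rcases (m a').1 ⟨le_rfl, hx.1.trans hx.2⟩ with h | h
    · exact absurd ⟨(le_antisymm (h ▸ hx.1) hx.2).ge, (h ▸ hq.1 : b ≤ q)⟩ hb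
    · exact le_antisymm hx.1 h.1
  subst hax
  have hqb : q < b := lt_of_le_of_ne hq.2 (by rintro rfl; exact hb ⟨haq, le_rfl⟩)
  refine ⟨b, .step h ha ⟨hqb, ?_⟩ ?_⟩
  · intro y hy hy'
    rcases (m y).1 ⟨haq.trans hy.le, hy'.le⟩ with h | h
    · exact hy'.ne h
    · exact hy.not_ge h.2
  · intro y hy hy'
    rcases (m y).1 ⟨hy, hy'⟩ with h | h
    · exact Or.inr (Or.inl h)
    · rcases hI y h.1 h.2 with h' | h'
      · exact Or.inl h'
      · exact Or.inr (Or.inr ⟨h', h.2⟩)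

theorem ax2_zero (hP : IsDComplete P) {a b w z x : P} (h : DI 0 a b w z) (hx : x ⋖ b) :
    x = w ∨ x = z := by
  have := hP.2.1 a b (up_iff.2 ⟨_, _, _, h⟩) x hx
  cases h with
  | base h1 h2 h3 h4 h5 h6 =>
    rcases h6 x this.1 this.2 with rfl | h | h | rfl
    · exact absurd h4.1 (hx.2 h1.1)
    · exact Or.inl h
    · exact Or.inr h
    · exact absurd rfl hx.1.ne

theorem ax2_succ (hP : IsDComplete P) {n : ℕ} {t q a b w z x : P} (h : DI n t q w z) (ha : a ⋖ t)
    (hb : q ⋖ b) (hI : ∀ x, a ≤ x → x ≤ b → x = a ∨ x = b ∨ (t ≤ x ∧ x ≤ q)) (hx : x ⋖ b) :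
    x = q := by
  have := hP.2.1 a b (up_iff.2 ⟨_, _, _, .step h ha hb hI⟩) x hx
  rcases hI x this.1 this.2 with rfl | rfl | h'
  · exact absurd hb.1 (hx.2 (ha.1.trans h.lt))
  · exact absurd rfl hx.1.ne
  · by_contra hne
    exact hx.2 (lt_of_le_of_ne h'.2 hne) hb.1

theorem ax2 (hP : IsDComplete P) {a b x : P} (h : Up a b) (hx : x ⋖ b) : a ≤ x :=
  (hP.2.1 a b (up_iff.2 h) x hx).1

theorem ax3a (hP : IsDComplete P) {a a2 w z : P} (h1 : a ⋖ w) (h2 : a ⋖ z) (h3 : a2 ⋖ w)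
    (h4 : a2 ⋖ z) (h5 : w ≠ z) : a = a2 := by
  have := hP.2.2 3 3 _ _ (three_convex h1 h2 h5) (three_convex h3 h4 h5) a (by simp) a2 (by simp)
    (by simp [h1.1.le, h2.1.le]) (by simp [h3.1.le, h4.1.le]) (by
      rw [Set.insert_sdiff_self_of_notMem, Set.insert_sdiff_self_of_notMem]
      · simp [h3.1.ne, h4.1.ne]
      · simp [h1.1.ne, h2.1.ne])
  have h : a ∈ ({a2, w, z} : Set P) := this ▸ (by simp)
  simpa [h1.1.ne, h2.1.ne] using h

theorem ax3b (hP : IsDComplete P) {n : ℕ} {t q w z a a2 : P} (h : DI n t q w z) (ha : a ⋖ t)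
    (hI : ∀ x, a ≤ x → x ≤ q → x = a ∨ t ≤ x) (ha2 : a2 ⋖ t)
    (hI2 : ∀ x, a2 ≤ x → x ≤ q → x = a2 ∨ t ≤ x) : a = a2 := by
  obtain ⟨c1, e1⟩ := convex_bot h ha hI
  obtain ⟨c2, e2⟩ := convex_bot h ha2 hI2
  have l1 : a ≤ q := ha.1.le.trans h.lt.le
  have l2 : a2 ≤ q := ha2.1.le.trans h.lt.le
  have := hP.2.2 _ _ _ _ c1 c2 a ⟨le_rfl, l1⟩ a2 ⟨le_rfl, l2⟩
    (fun x hx => hx.1) (fun x hx => hx.1) (by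
      rw [e1, e2, Set.insert_sdiff_self_of_notMem, Set.insert_sdiff_self_of_notMem]
      · exact fun hh => ha2.1.not_ge hh.1
      · exact fun hh => ha.1.not_ge hh.1)
  have m : a ∈ Set.Icc a2 q := this ▸ ⟨le_rfl, l1⟩
  have m2 : a2 ∈ Set.Icc a q := this ▸ ⟨le_rfl, l2⟩
  exact le_antisymm m2.1 m.1

end fin
end DCP

namespace DCP
variable {P : Type*} [PartialOrder P] [Finite P]

theorem no_triple (hP : IsDComplete P) : ∀ x1 x2 x3 : P, x1 ≠ x2 → x1 ≠ x3 → x2 ≠ x3 →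
    (∃ c, c ⋖ x1 ∧ c ⋖ x2) → (∃ c, c ⋖ x1 ∧ c ⋖ x3) → (∃ c, c ⋖ x2 ∧ c ⋖ x3) → False := by
  intro x1
  induction x1 using WellFoundedGT.induction with
  | ind x1 ih =>
    rintro x2 x3 n12 n13 n23 ⟨c, c1, c2⟩ ⟨d, d1, d2⟩ ⟨e, e1, e2⟩
    obtain ⟨y12, h12⟩ := ax1a hP c1 c2 n12
    obtain ⟨y13, h13⟩ := ax1a hP d1 d2 n13
    obtain ⟨y23, h23⟩ := ax1a hP e1 e2 n23
    have k12 := fun x => ax2_zero (x := x) hP h12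
    have k13 := fun x => ax2_zero (x := x) hP h13
    cases h12 with
    | base _ _ _ a1 a2 _ =>
    cases h13 with
    | base _ _ _ b1 b2 _ =>
    cases h23 with
    | base _ _ _ g1 g2 _ =>
    refine ih y12 a1.1 y13 y23 ?_ ?_ ?_ ⟨x1, a1, b1⟩ ⟨x2, a2, g1⟩ ⟨x3, b2, g2⟩
    · rintro rfl
      rcases k12 _ b2 with h | h
      · exact n13 h.symm
      · exact n23 h.symm
    · rintro rfl
      rcases k12 _ g2 with h | h
      · exact n13 h.symm
      · exact n23 h.symm
    · rintro rfl
      rcases k13 _ g1 with h | h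
      · exact n12 h.symm
      · exact n23 h

theorem cover_le (hP : IsDComplete P) {n : ℕ} {a b w z v : P} (h : DI n a b w z) (hv : a ⋖ v) :
    v ≤ b := by
  induction h generalizing v with
  | @base a b w z h1 h2 h3 h4 h5 h6 =>
    by_contra hc
    have e1 : v ≠ w := by rintro rfl; exact hc h4.1.le
    have e2 : v ≠ z := by rintro rfl; exact hc h5.1.le
    exact no_triple hP v w z e1 e2 h3 ⟨a, hv, h1⟩ ⟨a, hv, h2⟩ ⟨a, h1, h2⟩
  | @step n t q a b w z h h1 h2 h3 ih =>
    by_cases e : t = v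
    · subst e; exact h.lt.le.trans h2.1.le
    · obtain ⟨r, hr⟩ := ax1a hP h1 hv e
      cases hr with
      | base _ _ _ a1 a2 _ => exact a2.1.le.trans ((ih a1).trans h2.1.le)

theorem cover_zero (hP : IsDComplete P) {a b w z v : P} (h : DI 0 a b w z) (hv : a ⋖ v) :
    v = w ∨ v = z := by
  have hl := cover_le hP h hv
  cases h with
  | base h1 h2 h3 h4 h5 h6 =>
    rcases h6 v hv.1.le hl with h | h | h | h
    · exact absurd h hv.1.ne'
    · exact Or.inl h
    · exact Or.inr h
    · subst h; exact absurd h4.1 (hv.2 h1.1)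

theorem cover_succ (hP : IsDComplete P) {n : ℕ} {t q a b w z v : P} (h : DI n t q w z)
    (h1 : a ⋖ t) (h2 : q ⋖ b)
    (h3 : ∀ x, a ≤ x → x ≤ b → x = a ∨ x = b ∨ (t ≤ x ∧ x ≤ q)) (hv : a ⋖ v) : v = t := by
  have hl := cover_le hP (.step h h1 h2 h3) hv
  rcases h3 v hv.1.le hl with h' | h' | h'
  · exact absurd h' hv.1.ne'
  · subst h'
    exact absurd (h.lt.trans h2.1) (hv.2 h1.1)
  · by_contra hne
    exact hv.2 h1.1 (lt_of_le_of_ne h'.1 (Ne.symm hne))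

theorem above_of_unique {a t : P} (h : ∀ v, a ⋖ v → v = t) {x : P} (hx : a ≤ x) :
    x = a ∨ t ≤ x := by
  rcases hx.eq_or_lt with h' | h'
  · exact Or.inl h'.symm
  · obtain ⟨c, hc, hc'⟩ := exists_covBy_le_of_lt h'
    exact Or.inr (h c hc ▸ hc')

theorem up_inj (hP : IsDComplete P) {n : ℕ} {a b w z : P} (h : DI n a b w z) :
    ∀ {m : ℕ} {a2 w2 z2 : P}, DI m a2 b w2 z2 → a = a2 := by
  induction h with
  | @base a b w z h1 h2 h3 h4 h5 h6 =>
    intro m a2 w2 z2 hh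
    have hz := fun x => ax2_zero (x := x) hP (.base h1 h2 h3 h4 h5 h6)
    cases hh with
    | base g1 g2 g3 g4 g5 g6 =>
      rcases hz _ g4 with rfl | rfl <;> rcases hz _ g5 with rfl | rfl
      · exact absurd rfl g3
      · exact ax3a hP h1 h2 g1 g2 h3
      · exact ax3a hP h1 h2 g2 g1 h3
      · exact absurd rfl g3
    | step g g1 g2 g3 =>
      exact absurd ((ax2_succ hP g g1 g2 g3 h4).trans (ax2_succ hP g g1 g2 g3 h5).symm) h3
  | @step n t q a b w z h h1 h2 h3 ih =>
    intro m a2 w2 z2 hh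
    cases hh with
    | base g1 g2 g3 g4 g5 g6 =>
      exact absurd ((ax2_succ hP h h1 h2 h3 g4).trans (ax2_succ hP h h1 h2 h3 g5).symm) g3
    | step g g1 g2 g3 =>
      have := ax2_succ hP h h1 h2 h3 g2
      subst this
      have := ih g
      subst this
      exact ax3b hP h h1 (fun x hx _ => above_of_unique (fun v hv => cover_succ hP h h1 h2 h3 hv) hx)
        g1 (fun x hx _ => above_of_unique (fun v hv => cover_succ hP g g1 g2 g3 hv) hx)

theorem lemmaZ (hP : IsDComplete P) {m : ℕ} {a q w z : P} (h : DI m a q w z) :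
    ∀ {i : ℕ} {d b b2 : P}, DI i q d b b2 → (∀ p v, p ⋖ q → p ⋖ v → v = q) → False := by
  induction h with
  | @base a q w z h1 h2 h3 h4 h5 h6 =>
    intro i d b b2 hd hu
    exact h3 (ax3b hP hd h4 (fun x hx _ => above_of_unique (fun v hv => hu _ v h4 hv) hx) h5
      (fun x hx _ => above_of_unique (fun v hv => hu _ v h5 hv) hx))
  | @step n t q' a q w z h h1 h2 h3 ih =>
    intro i d b b2 hd hu
    obtain ⟨d', hd'⟩ := ax1b hP hd h2 (fun x hx _ => above_of_unique (fun v hv => hu _ v h2 hv) hx)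
    refine ih hd' ?_
    intro p v hp hv
    by_contra hne
    obtain ⟨r, hr⟩ := ax1a hP hp hv (Ne.symm hne)
    cases hr with
    | base _ _ _ a1 a2 _ =>
      have := hu _ _ h2 a1
      subst this
      exact hne (ax2_succ hP h h1 h2 h3 a2)

theorem up_fun (hP : IsDComplete P) {n : ℕ} {a b w z : P} (h : DI n a b w z) :
    ∀ {m : ℕ} {b2 w2 z2 : P}, DI m a b2 w2 z2 → b = b2 := by
  induction h with
  | @base a b w z h1 h2 h3 h4 h5 h6 =>
    intro m b2 w2 z2 hh
    have hz := fun x => cover_zero (v := x) hP (.base h1 h2 h3 h4 h5 h6)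
    cases hh with
    | base g1 g2 g3 g4 g5 g6 =>
      by_contra hne
      rcases hz _ g1 with rfl | rfl <;> rcases hz _ g2 with rfl | rfl
      · exact absurd rfl g3
      · exact h3 (ax3a hP h4 g4 h5 g5 hne)
      · exact h3 (ax3a hP h4 g5 h5 g4 hne)
      · exact absurd rfl g3
    | step g g1 g2 g3 =>
      exact absurd ((cover_succ hP g g1 g2 g3 h1).trans (cover_succ hP g g1 g2 g3 h2).symm) h3
  | @step n t q a b w z h h1 h2 h3 ih =>
    intro m b2 w2 z2 hh
    cases hh with
    | base g1 g2 g3 g4 g5 g6 =>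
      exact absurd ((cover_succ hP h h1 h2 h3 g1).trans (cover_succ hP h h1 h2 h3 g2).symm) g3
    | step g g1 g2 g3 =>
      have := cover_succ hP h h1 h2 h3 g1
      subst this
      have := ih g
      subst this
      by_contra hne
      obtain ⟨c, hc⟩ := ax1a hP h2 g2 hne
      refine lemmaZ hP h hc ?_
      intro p v hp hv
      by_contra hvq
      obtain ⟨r, hr⟩ := ax1a hP hp hv (Ne.symm hvq)
      cases hr with
      | base _ _ _ a1 a2 _ =>
        rcases cover_zero hP hc a1 with rfl | rfl
        · exact hvq (ax2_succ hP h h1 h2 h3 a2)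
        · exact hvq (ax2_succ hP g g1 g2 g3 a2)

theorem Up.inj (hP : IsDComplete P) {a a2 b : P} (h : Up a b) (h2 : Up a2 b) : a = a2 := by
  obtain ⟨_, _, _, h⟩ := h
  obtain ⟨_, _, _, h2⟩ := h2
  exact up_inj hP h h2

theorem Up.func (hP : IsDComplete P) {a b b2 : P} (h : Up a b) (h2 : Up a b2) : b = b2 := by
  obtain ⟨_, _, _, h⟩ := h
  obtain ⟨_, _, _, h2⟩ := h2
  exact up_fun hP h h2

theorem Up.lt {a b : P} (h : Up a b) : a < b := by
  obtain ⟨_, _, _, h⟩ := h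
  exact h.lt

theorem Up.diag {a b : P} (h : Up a b) : DiagRel a b := .rel _ _ (up_iff.2 h)

theorem _root_.DiagRel.sm {a b : P} (h : DiagRel a b) : DiagRel b a := .symm _ _ h
theorem _root_.DiagRel.tr {a b c : P} (h : DiagRel a b) (h' : DiagRel b c) : DiagRel a c := .trans _ _ _ h h'

theorem chain_of_diag (hP : IsDComplete P) {x y : P} (h : DiagRel x y) :
    Relation.ReflTransGen Up x y ∨ Relation.ReflTransGen Up y x := by
  induction h with
  | rel x y h => exact Or.inl (.single (up_iff.1 h))
  | refl x => exact Or.inl .refl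
  | symm x y _ ih => exact ih.symm
  | trans x y z _ _ h1 h2 =>
    rcases h1 with h1 | h1 <;> rcases h2 with h2 | h2
    · exact Or.inl (h1.trans h2)
    · have u : Relator.RightUnique (Function.swap (Up : P → P → Prop)) :=
        fun a b c h h' => Up.inj hP h h'
      have := Relation.ReflTransGen.total_of_right_unique u
        (Relation.reflTransGen_swap.2 h1) (Relation.reflTransGen_swap.2 h2)
      rcases this with h | h
      · exact Or.inr (Relation.reflTransGen_swap.1 h)
      · exact Or.inl (Relation.reflTransGen_swap.1 h)
    · have u : Relator.RightUnique (Up : P → P → Prop) :=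
        fun a b c h h' => Up.func hP h h'
      exact Relation.ReflTransGen.total_of_right_unique u h1 h2
    · exact Or.inr (h2.trans h1)

theorem chain_le {x y : P} (h : Relation.ReflTransGen Up x y) : x ≤ y := by
  induction h with
  | refl => exact le_rfl
  | tail _ h ih => exact ih.trans h.lt.le

theorem chain_diag {x y : P} (h : Relation.ReflTransGen Up x y) : DiagRel x y := by
  induction h with
  | refl => exact .refl _
  | tail _ h ih => exact ih.tr h.diag

theorem chain_of_lt (hP : IsDComplete P) {x y : P} (h : DiagRel x y) (hl : x ≤ y) :
    Relation.ReflTransGen Up x y := by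
  rcases chain_of_diag hP h with h | h
  · exact h
  · have := le_antisymm hl (chain_le h)
    subst this; exact .refl

theorem diag_comparable (hP : IsDComplete P) {x y : P} (h : DiagRel x y) : x ≤ y ∨ y ≤ x := by
  rcases chain_of_diag hP h with h | h
  · exact Or.inl (chain_le h)
  · exact Or.inr (chain_le h)

theorem next_up (hP : IsDComplete P) {x y : P} (h : DiagRel x y) (hl : x < y) :
    ∃ x', Up x x' ∧ x' ≤ y := by
  rcases (chain_of_lt hP h hl.le).cases_head with h | ⟨c, h1, h2⟩
  · exact absurd h hl.ne
  · exact ⟨c, h1, chain_le h2⟩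

theorem next_down (hP : IsDComplete P) {x y : P} (h : DiagRel x y) (hl : x < y) :
    ∃ y', Up y' y ∧ x ≤ y' := by
  rcases (chain_of_lt hP h hl.le).cases_tail with h | ⟨c, h1, h2⟩
  · exact absurd h hl.ne'
  · exact ⟨c, h2, chain_le h1⟩

theorem no_between (hP : IsDComplete P) {x y s : P} (h : Up x y) (h1 : x < s) (h2 : s < y) :
    ¬ DiagRel x s := by
  intro hd
  obtain ⟨x', hx, hl⟩ := next_up hP hd h1
  have := Up.func hP h hx
  subst this
  exact h2.not_ge hl

def IsTp (x : P) : Prop := ¬ ∃ y, Up x y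

theorem IsTp.unique_cover (hP : IsDComplete P) {x y y' : P} (h : IsTp x) (h1 : x ⋖ y)
    (h2 : x ⋖ y') : y = y' := by
  by_contra hne
  obtain ⟨b, hb⟩ := ax1a hP h1 h2 hne
  exact h ⟨b, _, _, _, hb⟩

theorem IsTp.cover (hP : IsDComplete P) {x y : P} (h : IsTp x) (h1 : x ⋖ y) : IsTp y := by
  rintro ⟨q, n, w, z, hq⟩
  obtain ⟨b, hb⟩ := ax1b hP hq h1
    (fun s hs _ => above_of_unique (fun v hv => h.unique_cover hP hv h1) hs)
  exact h ⟨b, _, _, _, hb⟩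

theorem IsTp.up (hP : IsDComplete P) {x y : P} (h : IsTp x) (hl : x ≤ y) : IsTp y := by
  induction x using WellFoundedGT.induction with
  | ind x ih =>
    rcases hl.eq_or_lt with rfl | hlt
    · exact h
    · obtain ⟨c, hc, hc'⟩ := exists_covBy_le_of_lt hlt
      exact ih c hc.1 (h.cover hP hc) hc'

theorem IsTp.uniq (hP : IsDComplete P) {x y : P} (h : IsTp x) (h' : IsTp y) (hd : DiagRel x y) :
    x = y := by
  by_contra hne
  rcases diag_comparable hP hd with hl | hl
  · obtain ⟨x', hx, _⟩ := next_up hP hd (lt_of_le_of_ne hl hne)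
    exact h ⟨_, hx⟩
  · obtain ⟨x', hx, _⟩ := next_up hP (DiagRel.sm hd) (lt_of_le_of_ne hl (Ne.symm hne))
    exact h' ⟨_, hx⟩

theorem gamma (hP : IsDComplete P) : ∀ {x y : P}, x ⋖ y → ∃ x' y', IsTp x' ∧ IsTp y' ∧
    DiagRel x x' ∧ DiagRel y y' ∧ (x' ⋖ y' ∨ y' ⋖ x') := by
  intro x
  induction x using WellFoundedGT.induction with
  | ind x ih =>
    intro y hxy
    by_cases ht : IsTp x
    · exact ⟨x, y, ht, ht.cover hP hxy, .refl _, .refl _, Or.inl hxy⟩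
    · simp only [IsTp, not_not] at ht
      obtain ⟨b, n, w, z, h⟩ := ht
      have hd : DiagRel x b := Up.diag ⟨n, w, z, h⟩
      suffices ∃ y1, DiagRel y y1 ∧ x < y1 ∧ y1 ⋖ b by
        obtain ⟨y1, g1, g2, g3⟩ := this
        obtain ⟨y', x', t1, t2, d1, d2, hc⟩ := ih y1 g2 g3
        exact ⟨x', y', t2, t1, hd.tr d2, g1.tr d1, hc.symm⟩
      cases h with
      | base h1 h2 h3 h4 h5 h6 =>
        rcases cover_zero hP (.base h1 h2 h3 h4 h5 h6) hxy with rfl | rfl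
        · exact ⟨_, .refl _, h1.1, h4⟩
        · exact ⟨_, .refl _, h2.1, h5⟩
      | @step n t q _ _ _ _ h h1 h2 h3 =>
        have := cover_succ hP h h1 h2 h3 hxy
        subst this
        exact ⟨q, Up.diag ⟨_, _, _, h⟩, h1.1.trans h.lt, h2⟩

def Adj (x y : P) : Prop := ∃ x' y', DiagRel x x' ∧ DiagRel y y' ∧ (x' ⋖ y' ∨ y' ⋖ x')

theorem Adj.symm {x y : P} (h : Adj x y) : Adj y x := by
  obtain ⟨x', y', h1, h2, h3⟩ := h
  exact ⟨y', x', h2, h1, h3.symm⟩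

theorem Adj.congr {x y x' y' : P} (h : Adj x y) (h1 : DiagRel x x') (h2 : DiagRel y y') :
    Adj x' y' := by
  obtain ⟨a, b, h3, h4, h5⟩ := h
  exact ⟨a, b, (DiagRel.sm h1).tr h3, (DiagRel.sm h2).tr h4, h5⟩

theorem Adj.of_cov {x y : P} (h : x ⋖ y) : Adj x y := ⟨x, y, .refl _, .refl _, Or.inl h⟩

theorem Adj.tops (hP : IsDComplete P) {x y : P} (h : Adj x y) : ∃ x' y', IsTp x' ∧ IsTp y' ∧
    DiagRel x x' ∧ DiagRel y y' ∧ (x' ⋖ y' ∨ y' ⋖ x') := by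
  obtain ⟨a, b, h3, h4, h5 | h5⟩ := h
  · obtain ⟨x', y', t1, t2, d1, d2, hc⟩ := gamma hP h5
    exact ⟨x', y', t1, t2, h3.tr d1, h4.tr d2, hc⟩
  · obtain ⟨x', y', t1, t2, d1, d2, hc⟩ := gamma hP h5
    exact ⟨y', x', t2, t1, h3.tr d2, h4.tr d1, hc.symm⟩

theorem Adj.not_diag (hP : IsDComplete P) {x y : P} (h : Adj x y) : ¬ DiagRel x y := by
  intro hd
  obtain ⟨x', y', t1, t2, d1, d2, hc⟩ := h.tops hP
  have := t1.uniq hP t2 (((DiagRel.sm d1).tr hd).tr d2)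
  subst this
  rcases hc with h | h <;> exact h.1.ne rfl

theorem Adj.tp_cov (hP : IsDComplete P) {x y : P} (h : Adj x y) (hx : IsTp x) (hy : IsTp y) :
    x ⋖ y ∨ y ⋖ x := by
  obtain ⟨x', y', t1, t2, d1, d2, hc⟩ := h.tops hP
  rw [hx.uniq hP t1 d1, hy.uniq hP t2 d2]
  exact hc

end DCP

namespace DCP
variable {P : Type*} [PartialOrder P] [Finite P]

theorem up_cases (hP : IsDComplete P) {x y : P} (h : Up x y) : ∃ r1 r2, x ⋖ r1 ∧ r2 ⋖ y ∧ r1 ≠ r2 ∧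
    ((x ⋖ r2 ∧ r1 ⋖ y ∧ (∀ v, x ⋖ v → v = r1 ∨ v = r2) ∧ (∀ v, v ⋖ y → v = r1 ∨ v = r2)) ∨
      (Up r1 r2 ∧ (∀ v, x ⋖ v → v = r1) ∧ (∀ v, v ⋖ y → v = r2))) ∧
    (∀ f : P → ℤ, (∀ p' p w z, IsDIntervalWith p' p w z → f p = f w + f z - f p') →
      f r1 + f r2 = f x + f y) := by
  obtain ⟨n, w, z, h⟩ := h
  have hw : IsDIntervalWith x y w z := ⟨_, h.toWith⟩
  cases h with
  | base h1 h2 h3 h4 h5 h6 =>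
    refine ⟨w, z, h1, h5, h3, Or.inl ⟨h2, h4,
      fun v hv => cover_zero hP (.base h1 h2 h3 h4 h5 h6) hv,
      fun v hv => ax2_zero hP (.base h1 h2 h3 h4 h5 h6) hv⟩, ?_⟩
    intro f hf
    rw [hf _ _ _ _ hw]; ring
  | @step n t q _ _ _ _ h h1 h2 h3 =>
    refine ⟨t, q, h1, h2, h.lt.ne, Or.inr ⟨⟨_, _, _, h⟩,
      fun v hv => cover_succ hP h h1 h2 h3 hv,
      fun v hv => ax2_succ hP h h1 h2 h3 hv⟩, ?_⟩
    intro f hf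
    rw [hf _ _ _ _ hw, hf _ _ _ _ (⟨_, h.toWith⟩ : IsDIntervalWith t q w z)]; ring

theorem core1 (hP : IsDComplete P) {x x' y y' : P} (hx : Up x x') (hy : Up y y')
    (h : x ⋖ y' ∨ y' ⋖ x') : x ≤ y ∨ y ≤ x := by
  rcases h with h | h
  · exact Or.inr (ax2 hP hy h)
  · obtain ⟨r1, r2, c1, c2, _, hc | hc, _⟩ := up_cases hP hx
    · rcases hc.2.2.2 _ h with rfl | rfl
      · exact Or.inr (ax2 hP hy c1)
      · exact Or.inr (ax2 hP hy hc.1)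
    · have := hc.2.2 _ h
      subst this
      have := Up.inj hP hy hc.1
      subst this
      exact Or.inl c1.1.le

theorem core2 (hP : IsDComplete P) {x x' y : P} (hx : Up x x') (hy : IsTp y) (hl : y < x')
    (ha : Adj y x) : x ≤ y := by
  have ht : IsTp x' := hy.up hP hl.le
  rcases (ha.congr (.refl _) hx.diag).tp_cov hP hy ht with h | h
  · exact ax2 hP hx h
  · exact absurd h.1 hl.not_gt

noncomputable def mu (x : P) : ℕ := (Set.Ici x).ncard

theorem mu_lt {x y : P} (h : x < y) : mu y < mu x := by
  apply Set.ncard_lt_ncard _ (Set.toFinite _)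
  exact Set.Ici_ssubset_Ici.2 h

theorem joint (hP : IsDComplete P) : ∀ N : ℕ,
    (∀ x y : P, Adj x y → mu x + mu y < N → x ≤ y ∨ y ≤ x) ∧
    (∀ x x' : P, Up x x' → mu x + mu x' < N → ∀ s, x < s → s < x' → Adj s x →
      x ⋖ s ∨ s ⋖ x') := by
  intro N
  induction N with
  | zero => exact ⟨fun _ _ _ h => absurd h (by omega), fun _ _ _ h => absurd h (by omega)⟩
  | succ N ih =>
    obtain ⟨ihC, ihA⟩ := ih
    constructor
    · intro x y ha hN
      by_contra hnot
      rw [not_or] at hnot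
      obtain ⟨nxy, nyx⟩ := hnot
      by_cases hx : IsTp x
      · by_cases hy : IsTp y
        · rcases ha.tp_cov hP hx hy with h | h
          · exact nxy h.1.le
          · exact nyx h.1.le
        · simp only [IsTp, not_not] at hy
          obtain ⟨y', hy⟩ := hy
          have := mu_lt hy.lt
          rcases ihC x y' (ha.congr (.refl _) hy.diag) (by omega) with h | h
          · rcases h.eq_or_lt with h | h
            · exact nyx (h ▸ hy.lt.le)
            · exact nyx (core2 hP hy hx h ha)
          · exact nyx (hy.lt.le.trans h)
      · simp only [IsTp, not_not] at hx
        obtain ⟨x', hx⟩ := hx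
        have m1 := mu_lt hx.lt
        have hyx' : y < x' := by
          rcases ihC x' y (ha.congr hx.diag (.refl _)) (by omega) with h | h
          · exact absurd (hx.lt.le.trans h) nxy
          · rcases h.eq_or_lt with h | h
            · exact absurd (h ▸ hx.lt.le) nxy
            · exact h
        have m2 := mu_lt hyx'
        by_cases hy : IsTp y
        · exact nxy (core2 hP hx hy hyx' ha.symm)
        · simp only [IsTp, not_not] at hy
          obtain ⟨y', hy⟩ := hy
          have m3 := mu_lt hy.lt
          have hxy' : x < y' := by
            rcases ihC x y' (ha.congr (.refl _) hy.diag) (by omega) with h | h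
            · rcases h.eq_or_lt with h | h
              · exact absurd (h ▸ hy.lt.le) nyx
              · exact h
            · exact absurd (hy.lt.le.trans h) nyx
          have m4 := mu_lt hxy'
          have ha' : Adj x' y' := ha.congr hx.diag hy.diag
          have hne : x' ≠ y' := by
            rintro h
            exact ha'.not_diag hP (h ▸ .refl _)
          rcases ihC x' y' ha' (by omega) with h | h
          · have := ihA y y' hy (by omega) x' hyx' (lt_of_le_of_ne h hne)
              (ha.congr hx.diag (.refl _))
            rcases core1 hP hy hx this with h | h
            · exact nyx h
            · exact nxy h
          · have := ihA x x' hx (by omega) y' hxy' (lt_of_le_of_ne h hne.symm)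
              (ha.congr (.refl _) hy.diag).symm
            rcases core1 hP hx hy this with h | h
            · exact nxy h
            · exact nyx h
    · intro x x' hx hN s
      induction s using WellFoundedGT.induction with
      | ind s ihs =>
        intro hxs hsx ha
        have ha' : Adj s x' := ha.congr (.refl _) hx.diag
        by_cases hs : IsTp s
        · rcases ha'.tp_cov hP hs (hs.up hP hsx.le) with h | h
          · exact Or.inr h
          · exact absurd h.1 hsx.not_gt
        simp only [IsTp, not_not] at hs
        obtain ⟨s', hs⟩ := hs
        have m1 := mu_lt hs.lt
        have m2 := mu_lt hxs
        have m3 := mu_lt hsx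
        have ha2 : Adj s' x' := ha'.congr hs.diag (.refl _)
        have hne : s' ≠ x' := by
          rintro h
          exact ha2.not_diag hP (h ▸ .refl _)
        rcases ihC s' x' ha2 (by omega) with h | h
        · have hl := lt_of_le_of_ne h hne
          rcases ihs s' hs.lt (hxs.trans hs.lt) hl (ha.congr hs.diag (.refl _)) with h | h
          · exact absurd hs.lt (h.2 hxs)
          · obtain ⟨r1, r2, c1, c2, _, hc | hc, _⟩ := up_cases hP hx
            · rcases hc.2.2.2 _ h with rfl | rfl
              · exact absurd hs.lt (c1.2 hxs)
              · exact absurd hs.lt (hc.1.2 hxs)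
            · have := hc.2.2 _ h
              subst this
              have := Up.inj hP hs hc.1
              subst this
              exact Or.inl c1
        · have hl := lt_of_le_of_ne h hne.symm
          have m4 := mu_lt hl
          rcases ihA s s' hs (by omega) x' hsx hl ha'.symm with h | h
          · exact Or.inr h
          · obtain ⟨r1, r2, c1, c2, _, hc | hc, _⟩ := up_cases hP hs
            · rcases hc.2.2.2 _ h with rfl | rfl
              · exact Or.inr c1
              · exact Or.inr hc.1
            · have := hc.2.2 _ h
              subst this
              have := Up.inj hP hx hc.1
              subst this
              exact absurd c1.1 hxs.not_gt

theorem Adj.comparable (hP : IsDComplete P) {x y : P} (h : Adj x y) : x ≤ y ∨ y ≤ x :=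
  (joint hP _).1 x y h (Nat.lt_succ_self _)

theorem Adj.ne (hP : IsDComplete P) {x y : P} (h : Adj x y) : x ≠ y := by
  rintro rfl
  exact h.not_diag hP (.refl _)

theorem count_lemma (hP : IsDComplete P) {x y : P} (h : Up x y) : ∃ r1 r2, x ⋖ r1 ∧ r2 ⋖ y ∧
    r1 ≠ r2 ∧ (∀ s, (x < s ∧ s < y ∧ Adj s x) ↔ s = r1 ∨ s = r2) ∧
    (∀ v, v ⋖ y → v = r2 ∨ (v = r1 ∧ x ⋖ r2)) ∧
    (DiagRel r1 r2 ∨ (¬ r1 ≤ r2 ∧ ¬ r2 ≤ r1)) ∧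
    (∀ f : P → ℤ, (∀ p' p w z, IsDIntervalWith p' p w z → f p = f w + f z - f p') →
      f r1 + f r2 = f x + f y) := by
  obtain ⟨r1, r2, c1, c2, hne, hc, hf⟩ := up_cases hP h
  refine ⟨r1, r2, c1, c2, hne, ?_, ?_, ?_, hf⟩
  · intro s
    constructor
    · rintro ⟨s1, s2, s3⟩
      have := (joint hP _).2 x y h (Nat.lt_succ_self _) s s1 s2 s3
      rcases hc with hc | hc
      · rcases this with h | h
        · exact hc.2.2.1 _ h
        · exact hc.2.2.2 _ h
      · rcases this with h | h
        · exact Or.inl (hc.2.1 _ h)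
        · exact Or.inr (hc.2.2 _ h)
    · have hl : r1 < y ∧ x < r2 := by
        rcases hc with hc | hc
        · exact ⟨hc.2.1.1, hc.1.1⟩
        · exact ⟨hc.1.lt.trans c2.1, c1.1.trans hc.1.lt⟩
      rintro (rfl | rfl)
      · exact ⟨c1.1, hl.1, (Adj.of_cov c1).symm⟩
      · exact ⟨hl.2, c2.1, (Adj.of_cov c2).congr (.refl _) h.diag.sm⟩
  · intro v hv
    rcases hc with hc | hc
    · rcases hc.2.2.2 _ hv with h | h
      · exact Or.inr ⟨h, hc.1⟩
      · exact Or.inl h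
    · exact Or.inl (hc.2.2 _ hv)
  · rcases hc with hc | hc
    · exact Or.inr ⟨not_le_of_common_lower c1 hc.1 hne, not_le_of_common_lower hc.1 c1 hne.symm⟩
    · exact Or.inl hc.1.diag

end DCP

namespace DCP
open Finset
open scoped Classical in
noncomputable def B {P : Type*} [PartialOrder P] (x z : P) : ℤ :=
  if DiagRel x z then 2 else if Adj x z then -1 else 0

open scoped Classical

section
variable {P : Type*} [PartialOrder P] [Finite P]

theorem B_diag {x z : P} (h : DiagRel x z) : B x z = 2 := by simp [B, h]

theorem B_congr {x x' z z' : P} (h : DiagRel x x') (h' : DiagRel z z') : B x z = B x' z' := by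
  have e1 : DiagRel x z ↔ DiagRel x' z' :=
    ⟨fun g => (h.sm.tr g).tr h', fun g => (h.tr g).tr h'.sm⟩
  have e2 : Adj x z ↔ Adj x' z' := ⟨fun g => g.congr h h', fun g => g.congr h.sm h'.sm⟩
  exact if_congr e1 rfl (if_congr e2 rfl rfl)

theorem B_symm (x z : P) : B x z = B z x := by
  have e1 : DiagRel x z ↔ DiagRel z x := ⟨DiagRel.sm, DiagRel.sm⟩
  have e2 : Adj x z ↔ Adj z x := ⟨Adj.symm, Adj.symm⟩
  exact if_congr e1 rfl (if_congr e2 rfl rfl)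

theorem B_nonpos {x z : P} (h : ¬ DiagRel x z) : B x z ≤ 0 := by
  simp only [B, h, if_false]; split_ifs <;> norm_num
end

variable {P : Type*} [PartialOrder P] [Fintype P]

theorem B_adj (hP : IsDComplete P) {x z : P} (h : Adj x z) : B x z = -1 := by
  simp [B, h.not_diag hP, h]

theorem B_zero (hP : IsDComplete P) {x z : P} (h1 : ¬ x ≤ z) (h2 : ¬ z ≤ x) : B x z = 0 := by
  have e1 : ¬ DiagRel x z := fun g => by
    rcases diag_comparable hP g with g | g <;> contradiction
  have e2 : ¬ Adj x z := fun g => by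
    rcases g.comparable hP with g | g <;> contradiction
  simp [B, e1, e2]

theorem pw_up (hP : IsDComplete P) {x x' r1 r2 z : P} (h : Up x x') (hne : r1 ≠ r2)
    (hr : ∀ s, (x < s ∧ s < x' ∧ Adj s x) ↔ s = r1 ∨ s = r2) (hz : x < z) :
    B x z = (if x' < z then B x' z else 0) + (if z = x' then 2 else 0)
      - (if z = r1 then 1 else 0) - (if z = r2 then 1 else 0) := by
  have l1 := ((hr r1).2 (Or.inl rfl))
  have l2 := ((hr r2).2 (Or.inr rfl))
  by_cases c1 : x' < z
  · have n1 : z ≠ r1 := by rintro rfl; exact c1.not_gt l1.2.1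
    have n2 : z ≠ r2 := by rintro rfl; exact c1.not_gt l2.2.1
    simp [c1, c1.ne', n1, n2, B_congr h.diag (.refl z : DiagRel z z)]
  by_cases c2 : z = x'
  · subst c2
    simp [l1.2.1.ne', l2.2.1.ne', B_diag h.diag]
  by_cases c3 : z < x'
  · have nd : ¬ DiagRel x z := no_between hP h hz c3
    by_cases e1 : z = r1
    · subst e1; simp [c1, c2, hne, B_adj hP l1.2.2.symm]
    by_cases e2 : z = r2
    · subst e2; simp [c1, c2, hne.symm, B_adj hP l2.2.2.symm]
    have na : ¬ Adj x z := fun g => by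
      rcases (hr z).1 ⟨hz, c3, g.symm⟩ with g | g <;> contradiction
    simp [B, nd, na, c1, c2, e1, e2]
  · have k1 : ¬ x' ≤ z := fun g => c1 (lt_of_le_of_ne g (Ne.symm c2))
    have k2 : ¬ z ≤ x' := fun g => c3 (lt_of_le_of_ne g c2)
    have n1 : z ≠ r1 := by rintro rfl; exact c3 l1.2.1
    have n2 : z ≠ r2 := by rintro rfl; exact c3 l2.2.1
    rw [B_congr h.diag (.refl z : DiagRel z z), B_zero hP k1 k2]
    simp [c1, c2, n1, n2]

theorem pw_down (hP : IsDComplete P) {x x' r1 r2 z : P} (h : Up x x') (hne : r1 ≠ r2)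
    (hr : ∀ s, (x < s ∧ s < x' ∧ Adj s x) ↔ s = r1 ∨ s = r2) (hz : z < x') :
    B z x' = (if z < x then B z x else 0) + (if z = x then 2 else 0)
      - (if z = r1 then 1 else 0) - (if z = r2 then 1 else 0) := by
  have l1 := ((hr r1).2 (Or.inl rfl))
  have l2 := ((hr r2).2 (Or.inr rfl))
  have e : B z x' = B z x := B_congr (.refl z : DiagRel z z) h.diag.sm
  rw [e]
  by_cases c1 : z < x
  · have n1 : z ≠ r1 := by rintro rfl; exact c1.not_gt l1.1
    have n2 : z ≠ r2 := by rintro rfl; exact c1.not_gt l2.1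
    simp [c1, c1.ne, n1, n2]
  by_cases c2 : z = x
  · subst c2
    simp [l1.1.ne, l2.1.ne, B_diag (.refl z : DiagRel z z)]
  by_cases c3 : x < z
  · rw [B_symm, pw_up hP h hne hr c3]
    simp [c1, c2, hz.not_gt, hz.ne]
  · have k1 : ¬ x ≤ z := fun g => c3 (lt_of_le_of_ne g (Ne.symm c2))
    have k2 : ¬ z ≤ x := fun g => c1 (lt_of_le_of_ne g c2)
    have n1 : z ≠ r1 := by rintro rfl; exact c3 l1.1
    have n2 : z ≠ r2 := by rintro rfl; exact c3 l2.1
    rw [B_zero hP k2 k1]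
    simp [c1, c2, n1, n2]

theorem sum_up (hP : IsDComplete P) {x x' : P} (h : Up x x') (S : Finset P)
    (h1 : ∀ z ∈ S, x < z) (h2 : ∀ z, x < z → z ≤ x' → z ∈ S) :
    ∑ z ∈ S, B x z = ∑ z ∈ S with x' < z, B x' z := by
  obtain ⟨r1, r2, _, _, hne, hr, _⟩ := count_lemma hP h
  have l1 := ((hr r1).2 (Or.inl rfl))
  have l2 := ((hr r2).2 (Or.inr rfl))
  have m1 := h2 r1 l1.1 l1.2.1.le
  have m2 := h2 r2 l2.1 l2.2.1.le
  have m3 := h2 x' h.lt le_rfl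
  rw [Finset.sum_congr rfl (fun z hz => pw_up hP h hne hr (h1 z hz))]
  rw [Finset.sum_sub_distrib, Finset.sum_sub_distrib, Finset.sum_add_distrib,
    Finset.sum_ite_eq', Finset.sum_ite_eq', Finset.sum_ite_eq', if_pos m1, if_pos m2, if_pos m3,
    Finset.sum_filter]
  ring

noncomputable def kap (u x : P) : ℤ := 1 + ∑ z with x < z ∧ z ≤ u, B x z
noncomputable def G (x : P) : ℤ := ∑ z with x < z, B x z

theorem kap_up (hP : IsDComplete P) {u x x' : P} (h : Up x x') (hl : x' ≤ u) :
    kap u x = kap u x' := by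
  unfold kap
  rw [sum_up hP h _ (by simp +contextual) (by
    intro z hz hz'; simp [hz, hz'.trans hl]), Finset.filter_filter]
  congr 2
  ext z
  simp only [mem_filter, mem_univ, true_and]
  constructor
  · rintro ⟨⟨_, h2⟩, h3⟩; exact ⟨h3, h2⟩
  · rintro ⟨h2, h3⟩; exact ⟨⟨h.lt.trans h2, h3⟩, h2⟩

theorem G_up (hP : IsDComplete P) {x x' : P} (h : Up x x') : G x = G x' := by
  unfold G
  rw [sum_up hP h _ (by simp) (by
    intro z hz hz'; simp [hz]), Finset.filter_filter]
  congr 1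
  ext z
  simp only [mem_filter, mem_univ, true_and]
  constructor
  · rintro ⟨_, h3⟩; exact h3
  · intro h2; exact ⟨h.lt.trans h2, h2⟩

theorem G_diag (hP : IsDComplete P) {x y : P} (h : DiagRel x y) : G x = G y := by
  induction h with
  | rel x y h => exact G_up hP (up_iff.1 h)
  | refl => rfl
  | symm _ _ _ ih => exact ih.symm
  | trans _ _ _ _ _ h1 h2 => exact h1.trans h2

theorem sum_nodiag (hP : IsDComplete P) {x : P} (S : Finset P) (h : ∀ z ∈ S, ¬ DiagRel x z) :
    ∑ z ∈ S, B x z = - ((S.filter (fun z => Adj x z)).card : ℤ) := by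
  rw [Finset.card_filter]
  push_cast
  rw [← Finset.sum_neg_distrib]
  refine Finset.sum_congr rfl fun z hz => ?_
  by_cases ha : Adj x z <;> simp [B, h z hz, ha]

theorem kap_top (hP : IsDComplete P) {u x : P} (h : ¬ ∃ x', Up x x' ∧ x' ≤ u) :
    kap u x = 1 - ((univ.filter (fun z => (x < z ∧ z ≤ u) ∧ Adj x z)).card : ℤ) := by
  unfold kap
  rw [sum_nodiag hP, Finset.filter_filter]
  · ring
  · intro z hz hd
    simp only [mem_filter, mem_univ, true_and] at hz
    obtain ⟨x', h1, h2⟩ := next_up hP hd hz.1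
    exact h ⟨x', h1, h2.trans hz.2⟩

theorem kap_top_le (hP : IsDComplete P) {u x : P} (h : ¬ ∃ x', Up x x' ∧ x' ≤ u) (hl : x < u) :
    kap u x ≤ 0 := by
  rw [kap_top hP h]
  obtain ⟨c, hc, hc'⟩ := exists_covBy_le_of_lt hl
  have : 0 < (univ.filter (fun z => (x < z ∧ z ≤ u) ∧ Adj x z)).card :=
    Finset.card_pos.2 ⟨c, by simp [hc.1, hc', Adj.of_cov hc]⟩
  omega

theorem kap_self (u : P) : kap u u = 1 := by
  unfold kap
  rw [Finset.sum_eq_zero]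
  · rfl
  · intro z hz
    simp only [mem_filter, mem_univ, true_and] at hz
    exact absurd hz.1 hz.2.not_gt

theorem kap_le (hP : IsDComplete P) {u : P} : ∀ {x : P}, x < u → ¬ DiagRel x u → kap u x ≤ 0 := by
  intro x
  induction x using WellFoundedGT.induction with
  | ind x ih =>
    intro hl hd
    by_cases h : ∃ x', Up x x' ∧ x' ≤ u
    · obtain ⟨x', h1, h2⟩ := h
      rw [kap_up hP h1 h2]
      have hd' : ¬ DiagRel x' u := fun g => hd (h1.diag.tr g)
      refine ih x' h1.lt (lt_of_le_of_ne h2 ?_) hd'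
      rintro rfl; exact hd' (.refl _)
    · exact kap_top_le hP h hl

theorem adj_above_tp (hP : IsDComplete P) {x z : P} (h : IsTp x) (hl : x < z) (ha : Adj x z) :
    x ⋖ z := by
  rcases ha.tp_cov hP h (h.up hP hl.le) with g | g
  · exact g
  · exact absurd g.1 hl.not_gt

theorem G_ge (hP : IsDComplete P) : ∀ x : P, -1 ≤ G x := by
  intro x
  induction x using WellFoundedGT.induction with
  | ind x ih =>
    by_cases h : IsTp x
    · unfold G
      rw [sum_nodiag hP]
      · have : (({z | x < z} : Finset P).filter (fun z => Adj x z)).card ≤ 1 := by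
          rw [Finset.card_le_one]
          intro a ha b hb
          simp only [mem_filter, mem_univ, true_and] at ha hb
          exact h.unique_cover hP (adj_above_tp hP h ha.1 ha.2) (adj_above_tp hP h hb.1 hb.2)
        omega
      · intro z hz hd
        simp only [mem_filter, mem_univ, true_and] at hz
        obtain ⟨x', h1, h2⟩ := next_up hP hd hz
        exact h ⟨x', h1⟩
    · simp only [IsTp, not_not] at h
      obtain ⟨x', hx⟩ := h
      rw [G_up hP hx]
      exact ih x' hx.lt

theorem G_max {x : P} (h : ∀ z, ¬ x < z) : G x = 0 := by
  unfold G
  rw [Finset.sum_eq_zero]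
  intro z hz
  simp only [mem_filter, mem_univ, true_and] at hz
  exact absurd hz (h z)

theorem sum_le_card (hP : IsDComplete P) {x : P} (S T : Finset P) (h : ∀ z ∈ S, ¬ DiagRel x z)
    (hT : T ⊆ S) (hA : ∀ z ∈ T, Adj x z) : ∑ z ∈ S, B x z ≤ - (T.card : ℤ) := by
  rw [sum_nodiag hP S h]
  have : T.card ≤ (S.filter (fun z => Adj x z)).card :=
    Finset.card_le_card fun z hz => by simp [hT hz, hA z hz]
  omega

theorem row (hP : IsDComplete P) {y u x : P} (h1 : y ≤ x) (h2 : x ≤ u) :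
    ∑ z with y ≤ z ∧ ¬ z ≤ u, B x z = G x + 1 - kap u x := by
  have e1 : ∑ z with y ≤ z ∧ ¬ z ≤ u, B x z = ∑ z with x < z ∧ ¬ z ≤ u, B x z := by
    symm
    apply Finset.sum_subset
    · intro z hz
      simp only [mem_filter, mem_univ, true_and] at hz ⊢
      exact ⟨h1.trans hz.1.le, hz.2⟩
    · intro z hz hz'
      simp only [mem_filter, mem_univ, true_and, not_and, not_not] at hz hz'
      refine B_zero hP ?_ ?_
      · intro g
        refine hz.2 (hz' (lt_of_le_of_ne g ?_))
        rintro rfl; exact hz.2 h2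
      · intro g; exact hz.2 (g.trans h2)
  have e2 : G x = ∑ z with x < z ∧ z ≤ u, B x z + ∑ z with x < z ∧ ¬ z ≤ u, B x z := by
    unfold G
    rw [← Finset.sum_filter_add_sum_filter_not _ (fun z => z ≤ u), Finset.filter_filter,
      Finset.filter_filter]
  rw [e1, e2, kap]; ring

theorem col (hP : IsDComplete P) {y u z : P}
    (hy : kap u y ≤ -1) (hnd : ∀ x, y ≤ x → x < u → ¬ DiagRel x u)
    (h2 : ∃ s1 s2, s1 ≠ s2 ∧ (y ≤ s1 ∧ s1 < u ∧ Adj s1 u) ∧ (y ≤ s2 ∧ s2 < u ∧ Adj s2 u)) :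
    ∑ x with y ≤ x ∧ x ≤ u, B x z ≤ 0 := by
  by_cases hx : ∃ x, (y ≤ x ∧ x ≤ u) ∧ DiagRel x z
  · obtain ⟨x1, hx1⟩ := (Set.toFinite {x | (y ≤ x ∧ x ≤ u) ∧ DiagRel x z}).exists_minimal hx
    obtain ⟨⟨a1, a2⟩, a3⟩ := hx1.1
    have hmin : ∀ x, y ≤ x → x ≤ u → DiagRel x1 x → x1 ≤ x := by
      intro x b1 b2 b3
      rcases diag_comparable hP b3 with g | g
      · exact g
      · exact hx1.2 ⟨⟨b1, b2⟩, b3.sm.tr a3⟩ g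
    have e0 : ∑ x with y ≤ x ∧ x ≤ u, B x z = ∑ x with y ≤ x ∧ x ≤ u, B x1 x :=
      Finset.sum_congr rfl fun x _ => by
        rw [B_symm x z]; exact B_congr a3.sm (.refl _)
    have e1 : ({x | y ≤ x ∧ x ≤ u} : Finset P).filter (fun x => x1 ≤ x)
        = insert x1 ({x | x1 < x ∧ x ≤ u} : Finset P) := by
      ext x
      simp only [mem_filter, mem_univ, true_and, mem_insert]
      constructor
      · rintro ⟨⟨_, b1⟩, b2⟩
        rcases b2.eq_or_lt with g | g
        · exact Or.inl g.symm
        · exact Or.inr ⟨g, b1⟩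
      · rintro (rfl | ⟨b1, b2⟩)
        · exact ⟨⟨a1, a2⟩, le_rfl⟩
        · exact ⟨⟨a1.trans b1.le, b2⟩, b1.le⟩
    rw [e0, ← Finset.sum_filter_add_sum_filter_not _ (fun x => x1 ≤ x), e1,
      Finset.sum_insert (by simp), B_diag (.refl x1 : DiagRel x1 x1)]
    have hk : kap u x1 = 1 + ∑ z with x1 < z ∧ z ≤ u, B x1 z := rfl
    set S := ({x | y ≤ x ∧ x ≤ u} : Finset P).filter (fun x => ¬ x1 ≤ x) with hS
    have hS' : ∀ x, x ∈ S ↔ (y ≤ x ∧ x ≤ u) ∧ ¬ x1 ≤ x := by simp [hS]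
    have nd : ∀ x ∈ S, ¬ DiagRel x1 x := by
      intro x hx hd
      rw [hS'] at hx
      exact hx.2 (hmin x hx.1.1 hx.1.2 hd)
    have key : ∀ T : Finset P, (∀ t ∈ T, y ≤ t ∧ t < x1 ∧ Adj t x1) →
        ∑ x ∈ S, B x1 x ≤ - (T.card : ℤ) := by
      intro T hT
      refine sum_le_card hP S T nd ?_ ?_
      · intro t ht
        obtain ⟨b1, b2, _⟩ := hT t ht
        exact (hS' t).2 ⟨⟨b1, b2.le.trans a2⟩, b2.not_ge⟩
      · intro t ht; exact (hT t ht).2.2.symm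
    by_cases c1 : x1 = y
    · have := key ∅ (by simp)
      rw [c1] at hk this ⊢
      simp only [card_empty] at this
      push_cast at this
      linarith
    by_cases c2 : x1 = u
    · obtain ⟨s1, s2, hne, g1, g2⟩ := h2
      have := key {s1, s2} (by
        intro t ht
        simp only [mem_insert, mem_singleton] at ht
        rw [c2]
        rcases ht with rfl | rfl
        · exact g1
        · exact g2)
      rw [Finset.card_pair hne] at this
      rw [c2, kap_self] at hk
      rw [c2] at this ⊢
      push_cast at this
      linarith
    · have hlt : y < x1 := lt_of_le_of_ne a1 (Ne.symm c1)
      have hlu : x1 < u := lt_of_le_of_ne a2 c2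
      obtain ⟨v, v1, v2⟩ := exists_le_covBy_of_lt hlt
      have := key {v} (by simp [v1, v2.1, Adj.of_cov v2])
      have k0 := kap_le hP hlu (hnd x1 a1 hlu)
      simp only [card_singleton] at this
      push_cast at this
      linarith
  · apply Finset.sum_nonpos
    intro x hx'
    simp only [mem_filter, mem_univ, true_and] at hx'
    exact B_nonpos fun g => hx ⟨x, hx', g⟩

theorem m1 (hP : IsDComplete P) {y c r1 r2 : P} (hup : Up y c) (hne : r1 ≠ r2)
    (hr : ∀ s, (y < s ∧ s < c ∧ Adj s y) ↔ s = r1 ∨ s = r2)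
    (hd : DiagRel r1 r2 ∨ (¬ r1 ≤ r2 ∧ ¬ r2 ≤ r1)) :
    ∀ u, ¬ c ≤ u → r1 ≤ u → r2 ≤ u → ∃ x, y ≤ x ∧ x < u ∧ DiagRel x u := by
  intro u
  induction u using WellFoundedLT.induction with
  | ind u ih =>
    intro hcu l1 l2
    by_contra hcon
    have hnd : ∀ x, y ≤ x → x < u → ¬ DiagRel x u := fun x b1 b2 b3 => hcon ⟨x, b1, b2, b3⟩
    have p1 := ((hr r1).2 (Or.inl rfl))
    have p2 := ((hr r2).2 (Or.inr rfl))
    have n1 : r1 ≠ u := by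
      rintro rfl
      rcases hd with g | g
      · exact hnd r2 p2.1.le (lt_of_le_of_ne l2 hne.symm) g.sm
      · exact g.2 l2
    have n2 : r2 ≠ u := by
      rintro rfl
      rcases hd with g | g
      · exact hnd r1 p1.1.le (lt_of_le_of_ne l1 hne) g
      · exact g.1 l1
    obtain ⟨v1, v1l, v1c⟩ := exists_le_covBy_of_lt (lt_of_le_of_ne l1 n1)
    obtain ⟨v2, v2l, v2c⟩ := exists_le_covBy_of_lt (lt_of_le_of_ne l2 n2)
    have h2 : ∃ s1 s2, s1 ≠ s2 ∧ (y ≤ s1 ∧ s1 < u ∧ Adj s1 u) ∧ (y ≤ s2 ∧ s2 < u ∧ Adj s2 u) := by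
      by_cases e : v1 = v2
      · subst e
        obtain ⟨x, b1, b2, b3⟩ := ih v1 v1c.1 (fun g => hcu (g.trans v1c.1.le)) v1l v2l
        exact ⟨x, v1, b2.ne, ⟨b1, b2.trans v1c.1, (Adj.of_cov v1c).congr b3.sm (.refl _)⟩,
          ⟨b1.trans b2.le, v1c.1, Adj.of_cov v1c⟩⟩
      · exact ⟨v1, v2, e, ⟨p1.1.le.trans v1l, v1c.1, Adj.of_cov v1c⟩,
          ⟨p2.1.le.trans v2l, v2c.1, Adj.of_cov v2c⟩⟩
    have hyu : y < u := p1.1.trans_le l1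
    have hky : kap u y ≤ -1 := by
      rw [kap_top hP (by
        rintro ⟨x', g1, g2⟩
        exact hcu (Up.func hP hup g1 ▸ g2))]
      have : ({r1, r2} : Finset P).card ≤
          (univ.filter (fun z => (y < z ∧ z ≤ u) ∧ Adj y z)).card := by
        apply Finset.card_le_card
        intro t ht
        simp only [mem_insert, mem_singleton] at ht
        simp only [mem_filter, mem_univ, true_and]
        rcases ht with rfl | rfl
        · exact ⟨⟨p1.1, l1⟩, p1.2.2.symm⟩
        · exact ⟨⟨p2.1, l2⟩, p2.2.2.symm⟩
      rw [Finset.card_pair hne] at this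
      omega
    set K := ({x | y ≤ x ∧ x ≤ u} : Finset P) with hK
    set F := ({z | y ≤ z ∧ ¬ z ≤ u} : Finset P) with hF
    have hK' : ∀ x, x ∈ K ↔ y ≤ x ∧ x ≤ u := by simp [hK]
    have hF' : ∀ x, x ∈ F ↔ y ≤ x ∧ ¬ x ≤ u := by simp [hF]
    have hcol : ∀ z ∈ F, ∑ x ∈ K, B x z ≤ 0 := fun z _ => col hP hky hnd h2
    have hrow : ∀ x ∈ K, (G x + 1) + (if x = y then 1 else 0) - (if x = u then 1 else 0)
        ≤ ∑ z ∈ F, B x z := by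
      intro x hx
      rw [hK'] at hx
      rw [row hP hx.1 hx.2]
      by_cases c1 : x = y
      · subst c1; simp [hyu.ne]; linarith
      by_cases c2 : x = u
      · subst c2; simp [kap_self, c1]
      · have hlu := lt_of_le_of_ne hx.2 c2
        have := kap_le hP hlu (hnd x hx.1 hlu)
        simp [c1, c2]; linarith
    have tot : ∑ x ∈ K, (G x + 1) ≤ ∑ z ∈ F, ∑ x ∈ K, B x z := by
      rw [Finset.sum_comm]
      refine le_trans (le_of_eq ?_) (Finset.sum_le_sum hrow)
      have e0 : ∀ g : P → ℤ, ∑ x ∈ K, (g x + (if x = y then 1 else 0) - (if x = u then 1 else 0))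
          = ∑ x ∈ K, g x + 1 - 1 := by
        intro g
        rw [Finset.sum_sub_distrib, Finset.sum_add_distrib, Finset.sum_ite_eq',
          Finset.sum_ite_eq', if_pos ((hK' y).2 ⟨le_rfl, hyu.le⟩),
          if_pos ((hK' u).2 ⟨hyu.le, le_rfl⟩)]
      rw [e0 (fun x => G x + 1)]
      ring
    have hG0 : ∀ x ∈ K, 0 ≤ G x + 1 := fun x _ => by have := G_ge hP x; linarith
    obtain ⟨M, hM⟩ := (Set.toFinite {x | u ≤ x}).exists_maximal ⟨u, le_rfl⟩
    have hGM : G M = 0 := G_max fun z hz => hz.not_ge (hM.2 (hM.1.trans hz.le) hz.le)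
    by_cases hMK : ∃ x ∈ K, DiagRel x M
    · obtain ⟨x, xK, xd⟩ := hMK
      have g1 := Finset.single_le_sum hG0 xK
      have g2 := Finset.sum_nonpos hcol
      rw [G_diag hP xd, hGM] at g1
      linarith
    · obtain ⟨z, hz⟩ := (Set.toFinite {z | u ≤ z ∧ ¬ ∃ x ∈ K, DiagRel x z}).exists_minimal
        ⟨M, hM.1, hMK⟩
      obtain ⟨z1, z2⟩ := hz.1
      have huz : u < z := lt_of_le_of_ne z1 (by
        rintro rfl
        exact z2 ⟨u, (hK' u).2 ⟨hyu.le, le_rfl⟩, .refl _⟩)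
      obtain ⟨v, vl, vc⟩ := exists_le_covBy_of_lt huz
      have hv : ∃ x ∈ K, DiagRel x v := by
        by_contra g
        exact vc.1.not_ge (hz.2 ⟨vl, g⟩ vc.1.le)
      obtain ⟨x, xK, xd⟩ := hv
      have zF : z ∈ F := (hF' z).2 ⟨hyu.le.trans z1, huz.not_ge⟩
      have hneg : ∑ x ∈ K, B x z < 0 := by
        apply Finset.sum_neg' (fun t ht => B_nonpos fun g => z2 ⟨t, ht, g⟩)
        refine ⟨x, xK, ?_⟩
        rw [B_adj hP ((Adj.of_cov vc).congr xd.sm (.refl _))]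
        norm_num
      have g2 : ∑ z ∈ F, ∑ x ∈ K, B x z < 0 := Finset.sum_neg' hcol ⟨z, zF, hneg⟩
      have g3 := Finset.sum_nonneg hG0
      linarith

theorem lemmaM (hP : IsDComplete P) {x : P} (hx : ¬ ∃ x', Up x' x) :
    ∀ y, y < x → kap x y = 0 := by
  intro y
  induction y using WellFoundedGT.induction with
  | ind y ih =>
    intro hl
    by_cases h : ∃ y', Up y y' ∧ y' ≤ x
    · obtain ⟨y', h1, h2⟩ := h
      rw [kap_up hP h1 h2]
      refine ih y' h1.lt (lt_of_le_of_ne h2 ?_)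
      rintro rfl; exact hx ⟨y, h1⟩
    · apply le_antisymm (kap_top_le hP h hl)
      rw [kap_top hP h]
      have : (univ.filter (fun z => (y < z ∧ z ≤ x) ∧ Adj y z)).card ≤ 1 := by
        rw [Finset.card_le_one]
        intro a ha b hb
        simp only [mem_filter, mem_univ, true_and] at ha hb
        by_cases ht : IsTp y
        · exact ht.unique_cover hP (adj_above_tp hP ht ha.1.1 ha.2)
            (adj_above_tp hP ht hb.1.1 hb.2)
        simp only [IsTp, not_not] at ht
        obtain ⟨c, hc⟩ := ht
        have hcx : ¬ c ≤ x := fun g => h ⟨c, hc, g⟩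
        obtain ⟨r1, r2, _, _, hne, hr, _, hd, _⟩ := count_lemma hP hc
        have q : ∀ z, (y < z ∧ z ≤ x) ∧ Adj y z → z = r1 ∨ z = r2 := by
          rintro z ⟨⟨g1, g2⟩, g3⟩
          refine (hr z).1 ⟨g1, ?_, g3.symm⟩
          rcases (g3.congr hc.diag (.refl _)).comparable hP with g | g
          · exact absurd (g.trans g2) hcx
          · refine lt_of_le_of_ne g ?_
            rintro rfl; exact hcx g2
        have fin : r1 ≤ x → r2 ≤ x → False := by
          intro g1 g2
          obtain ⟨w, w1, w2, w3⟩ := m1 hP hc hne hr hd x hcx g1 g2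
          obtain ⟨x', t1, _⟩ := next_down hP w3 w2
          exact hx ⟨x', t1⟩
        rcases q a ha with rfl | rfl <;> rcases q b hb with rfl | rfl
        · rfl
        · exact (fin ha.1.2 hb.1.2).elim
        · exact (fin hb.1.2 ha.1.2).elim
        · rfl
      omega

theorem neck_up {n : ℕ} {a b w z p : P} (h : DI n a b w z) (h1 : a ≤ p) (h2 : p ≤ b)
    (h3 : w ≤ p) (h4 : z ≤ p) : ∃ x', Up x' p := by
  induction h with
  | @base a b w z g1 g2 g3 g4 g5 g6 =>
    rcases g6 p h1 h2 with rfl | rfl | rfl | rfl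
    · exact absurd g1.1 h3.not_gt
    · exact absurd h4 (not_le_of_common_lower g2 g1 g3.symm)
    · exact absurd h3 (not_le_of_common_lower g1 g2 g3)
    · exact ⟨a, _, _, _, .base g1 g2 g3 g4 g5 g6⟩
  | @step n t q a b w z g g1 g2 g3 ih =>
    rcases g3 p h1 h2 with rfl | rfl | h
    · exact absurd h3 (DI.facts (.step g g1 g2 g3)).1.not_ge
    · exact ⟨a, _, _, _, .step g g1 g2 g3⟩
    · exact ih h.1 h.2 h3 h4

theorem not_neck {p : P} (h : ¬ ∃ x', Up x' p) : ¬ ∃ a b : P, IsNeckOf p a b := by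
  rintro ⟨a, b, k, w, z, hk, hp, h1, h2⟩
  have h3 : 3 ≤ k := hk.2.1.1
  obtain ⟨n, rfl⟩ := Nat.exists_eq_add_of_le' h3
  exact h (neck_up (DI.ofWith hk) hp.1 hp.2 h1 h2)

theorem star (hP : IsDComplete P) (f ind : P → ℤ)
    (hf1 : ∀ p, (¬ ∃ x', Up x' p) → f p = ∑ r with r ≤ p, ind r)
    (hf2 : ∀ p' p w z, IsDIntervalWith p' p w z → f p = f w + f z - f p')
    (hi : ∀ x y, DiagRel x y → ind x = ind y) :
    ∀ x, f x + ∑ y with y < x, B y x * f y = ind x := by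
  intro x
  induction x using WellFoundedLT.induction with
  | ind x ih =>
    by_cases hx : ∃ x', Up x' x
    · obtain ⟨x', hx⟩ := hx
      obtain ⟨r1, r2, _, _, hne, hr, _, _, hf⟩ := count_lemma hP hx
      have l1 := ((hr r1).2 (Or.inl rfl))
      have l2 := ((hr r2).2 (Or.inr rfl))
      have hf := hf f hf2
      have e : ∑ y with y < x, B y x * f y =
          ∑ y with y < x', B y x' * f y + 2 * f x' - f r1 - f r2 := by
        rw [Finset.sum_congr rfl (fun z hz => by
          rw [pw_down hP hx hne hr (by simpa using hz), sub_mul, sub_mul, add_mul, ite_mul, ite_mul,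
            ite_mul, ite_mul])]
        simp only [zero_mul, one_mul]
        rw [Finset.sum_sub_distrib, Finset.sum_sub_distrib, Finset.sum_add_distrib,
          Finset.sum_ite_eq', Finset.sum_ite_eq', Finset.sum_ite_eq',
          if_pos (by simp [hx.lt]), if_pos (by simp [l1.2.1]), if_pos (by simp [l2.2.1]),
          ← Finset.sum_filter, Finset.filter_filter]
        congr 4
        ext z
        simp only [mem_filter, mem_univ, true_and]
        exact ⟨fun g => g.2, fun g => ⟨g.trans hx.lt, g⟩⟩
      have := ih x' hx.lt
      rw [e, ← hi x' x hx.diag]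
      linarith
    · have e1 : f x = ind x + ∑ y with y < x, ind y := by
        rw [hf1 x hx]
        have : ({r | r ≤ x} : Finset P) = insert x ({r | r < x} : Finset P) := by
          ext z; simp [le_iff_eq_or_lt]
        rw [this, Finset.sum_insert (by simp)]
      have e2 : ∑ y with y < x, ind y =
          ∑ y with y < x, f y + ∑ y with y < x, ∑ y' with y' < y, B y' y * f y' := by
        rw [← Finset.sum_add_distrib]
        refine Finset.sum_congr rfl fun y hy => ?_
        exact (ih y (by simpa using hy)).symm
      have e3 : ∑ y with y < x, ∑ y' with y' < y, B y' y * f y' =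
          ∑ y' with y' < x, ∑ y with y' < y ∧ y < x, B y' y * f y' := by
        apply Finset.sum_comm'
        intro y y'
        simp only [mem_filter, mem_univ, true_and]
        constructor
        · rintro ⟨g1, g2⟩; exact ⟨⟨g2, g1⟩, g2.trans g1⟩
        · rintro ⟨⟨g2, g1⟩, _⟩; exact ⟨g1, g2⟩
      have e4 : ∀ y', y' < x → ∑ y with y' < y ∧ y < x, B y' y * f y'
          = - f y' - B y' x * f y' := by
        intro y' hy'
        have hk := lemmaM hP hx y' hy'
        unfold kap at hk
        have : ({z | y' < z ∧ z ≤ x} : Finset P) = insert x ({z | y' < z ∧ z < x} : Finset P) := by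
          ext z
          simp only [mem_filter, mem_univ, true_and, mem_insert, le_iff_eq_or_lt]
          constructor
          · rintro ⟨g1, g2 | g2⟩
            · exact Or.inl g2
            · exact Or.inr ⟨g1, g2⟩
          · rintro (rfl | g)
            · exact ⟨hy', Or.inl rfl⟩
            · exact ⟨g.1, Or.inr g.2⟩
        rw [this, Finset.sum_insert (by simp)] at hk
        rw [← Finset.sum_mul]
        linear_combination f y' * hk
      have e5 : ∑ y' with y' < x, ∑ y with y' < y ∧ y < x, B y' y * f y' =
          - ∑ y with y < x, f y - ∑ y with y < x, B y x * f y := by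
        rw [← Finset.sum_neg_distrib, ← Finset.sum_sub_distrib]
        exact Finset.sum_congr rfl fun y hy => e4 y (by simpa using hy)
      rw [e1, e2, e3, e5]; ring

theorem positivity_main (hP : IsDComplete P) (f ind : P → ℤ)
    (hf1 : ∀ p, (¬ ∃ x', Up x' p) → f p = ∑ r with r ≤ p, ind r)
    (hf2 : ∀ p' p w z, IsDIntervalWith p' p w z → f p = f w + f z - f p')
    (hi : ∀ x y, DiagRel x y → ind x = ind y) (hi0 : ∀ x, 0 ≤ ind x) :
    ∀ x, 0 ≤ f x ∧ ∀ y, y ⋖ x → f y ≤ f x := by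
  intro x
  induction x using WellFoundedLT.induction with
  | ind x ih =>
    by_cases hx : ∃ x', Up x' x
    · obtain ⟨x', hx⟩ := hx
      obtain ⟨r1, r2, c1, c2, hne, hr, hlow, _, hf⟩ := count_lemma hP hx
      have l1 := ((hr r1).2 (Or.inl rfl))
      have l2 := ((hr r2).2 (Or.inr rfl))
      have hf := hf f hf2
      have i1 := (ih r1 l1.2.1).2 x' c1
      have i2 := (ih r2 l2.2.1).1
      refine ⟨by linarith, ?_⟩
      intro y hy
      rcases hlow y hy with rfl | ⟨rfl, h2⟩
      · linarith
      · have := (ih r2 l2.2.1).2 x' h2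
        linarith
    · have hs := star hP f ind hf1 hf2 hi x
      have e : f x = ind x + ∑ y with y < x, (- B y x * f y) := by
        rw [← hs]
        simp only [neg_mul, Finset.sum_neg_distrib]
        ring
      have nn : ∀ y ∈ ({y | y < x} : Finset P), 0 ≤ - B y x * f y := by
        intro y hy
        simp only [mem_filter, mem_univ, true_and] at hy
        refine mul_nonneg ?_ (ih y hy).1
        have : B y x ≤ 0 := B_nonpos fun g => by
          obtain ⟨x', t, _⟩ := next_down hP g hy
          exact hx ⟨x', t⟩
        linarith
      constructor
      · rw [e]; exact add_nonneg (hi0 x) (Finset.sum_nonneg nn)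
      · intro y hy
        have := Finset.single_le_sum nn (a := y) (by simp [hy.1])
        rw [B_adj hP (Adj.of_cov hy)] at this
        have h0 := hi0 x
        linarith

end DCP

/-- Hook vectors of a d-complete poset have nonnegative entries. -/
theorem hookVector_nonneg {P : Type*} [PartialOrder P] [Fintype P]
    (hP : IsDComplete P) (h : P → Quotient (diagSetoid P) → ℤ)
    (hh : IsHookVector h) (p : P) (D : Quotient (diagSetoid P)) :
    0 ≤ h p D := by
  classical
  refine (DCP.positivity_main hP (fun x => h x D)
    (fun x => if Quotient.mk (diagSetoid P) x = D then 1 else 0) ?_ ?_ ?_ ?_ p).1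
  · intro p hp
    show h p D = _
    rw [hh.1 p (DCP.not_neck hp) D, ← Finset.sum_filter, Finset.filter_filter, Finset.sum_const,
      nsmul_eq_mul, mul_one, ← Set.ncard_coe_finset]
    congr 2
    ext r
    simp [and_comm]
  · intro p' p w z hw
    exact hh.2 p' p w z hw D
  · intro x y hd
    have : Quotient.mk (diagSetoid P) x = Quotient.mk (diagSetoid P) y := Quotient.sound hd
    simp only [this]
  · intro x
    split_ifs <;> norm_num
end

section
/- Every d-complete poset has a stable insertion order: a linear extension p₁ > p₂ > ⋯ > pₙ such that whenever pᵢ is the bottom element of a d-interval of P, the side elements of that d-interval are not neck elements of any d-interval contained in {p₁, …, pᵢ}. -/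
variable {P : Type*} [PartialOrder P]

section Helpers

theorem aux_d3 {Q : Type*} [PartialOrder Q] (hP : IsDComplete Q) {v w z : Q}
    (hw : v ⋖ w) (hz : v ⋖ z) (hne : w ≠ z) :
    ∃ q, w ⋖ q ∧ z ⋖ q ∧ ∀ y, y ⋖ q → y = w ∨ y = z := by
  have hwz : ¬ w ≤ z := fun h => (hz.2 hw.1 (lt_of_le_of_ne h hne))
  have hzw : ¬ z ≤ w := fun h => (hw.2 hz.1 (lt_of_le_of_ne h hne.symm))
  have hvw := hw.1
  have hvz := hz.1
  have hwv : ¬ w ≤ v := fun h => (lt_irrefl _ (hvw.trans_le h))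
  have hzv : ¬ z ≤ v := fun h => (lt_irrefl _ (hvz.trans_le h))
  have hS : IsDkMinusConvex 3 ({v, w, z} : Set Q) := by
    refine ⟨?_, w, z, ⟨le_refl _, by simp, by simp, hwz, hzw, ?_, ?_, ?_, ?_⟩, ?_⟩
    · have key : ∀ c x, v ⋖ c → v ≤ x → x ≤ c → x = v ∨ x = c := by
        intro c x hc h1 h2
        exact (hc.eq_or_eq h1 h2)
      rintro a (rfl | rfl | rfl) b (rfl | rfl | rfl) x hax hxb
      · left; exact le_antisymm hxb hax
      · rcases key _ x hw hax hxb with h | h <;> simp [h]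
      · rcases key _ x hz hax hxb with h | h <;> simp [h]
      · exact absurd (hax.trans hxb) hwv
      · right; left; exact le_antisymm hxb hax
      · exact absurd (hax.trans hxb) hwz
      · exact absurd (hax.trans hxb) hzv
      · exact absurd (hax.trans hxb) hzw
      · right; right; exact le_antisymm hxb hax
    · rintro x (rfl | rfl | rfl)
      · exact Or.inr (Or.inr (Or.inl ⟨hvw.le, hvz.le⟩))
      · exact Or.inl rfl
      · exact Or.inr (Or.inl rfl)
    · rintro x ⟨(rfl | rfl | rfl), h1, h2⟩ y ⟨(rfl | rfl | rfl), h3, h4⟩ hxy <;> simp_all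
    · rintro x ⟨(rfl | rfl | rfl), h1, h2⟩ y ⟨(rfl | rfl | rfl), h3, h4⟩ hxy <;> simp_all
    · have : {x ∈ ({v, w, z} : Set Q) | x ≤ w ∧ x ≤ z} = {v} := by
        ext x
        constructor
        · rintro ⟨(rfl | rfl | rfl), h1, h2⟩ <;> simp_all
        · rintro rfl
          exact ⟨by simp, hvw.le, hvz.le⟩
      rw [this]; simp
    · have : {x ∈ ({v, w, z} : Set Q) | w ≤ x ∧ z ≤ x} = ∅ := by
        ext x
        constructor
        · rintro ⟨(rfl | rfl | rfl), h1, h2⟩ <;> simp_all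
        · rintro ⟨⟩
      rw [this]; simp
  obtain ⟨q, hq, a, hI, hIcc⟩ := hP.1 3 _ hS
  have hmem : ∀ x, x ∈ Set.Icc a q ↔ x = q ∨ x = v ∨ x = w ∨ x = z := by
    intro x; rw [hIcc]; simp
  have hqv : q ≠ v := fun h => hq (by simp [h])
  have hqw : q ≠ w := fun h => hq (by simp [h])
  have hqz : q ≠ z := fun h => hq (by simp [h])
  have hwI := (hmem w).2 (by simp)
  have hzI := (hmem z).2 (by simp)
  have hwq : w < q := lt_of_le_of_ne hwI.2 hqw.symm
  have hzq : z < q := lt_of_le_of_ne hzI.2 hqz.symm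
  refine ⟨q, ⟨hwq, ?_⟩, ⟨hzq, ?_⟩, ?_⟩
  · intro c h1 h2
    rcases (hmem c).1 ⟨hwI.1.trans h1.le, h2.le⟩ with rfl | rfl | rfl | rfl
    · exact lt_irrefl _ h2
    · exact hwv h1.le
    · exact lt_irrefl _ h1
    · exact hwz h1.le
  · intro c h1 h2
    rcases (hmem c).1 ⟨hzI.1.trans h1.le, h2.le⟩ with rfl | rfl | rfl | rfl
    · exact lt_irrefl _ h2
    · exact hzv h1.le
    · exact hzw h1.le
    · exact lt_irrefl _ h1
  · intro y hy
    rcases (hmem y).1 (hP.2.1 a q ⟨3, hI⟩ y hy) with rfl | rfl | rfl | rfl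
    · exact absurd hy.1 (lt_irrefl _)
    · exact absurd hwq (hy.2 hvw)
    · exact Or.inl rfl
    · exact Or.inr rfl

theorem aux_pattern {Q : Type*} [PartialOrder Q] [Finite Q] (hP : IsDComplete Q) (w : Q) :
    ∀ z u : Q, w ≠ z → w ≠ u → z ≠ u → (∃ v, v ⋖ w ∧ v ⋖ z) → (∃ v, v ⋖ w ∧ v ⋖ u) →
      (∃ v, v ⋖ z ∧ v ⋖ u) → False := by
  induction w using WellFoundedGT.induction with
  | ind w ih =>
    rintro z u hwz hwu hzu ⟨v1, h1, h1'⟩ ⟨v2, h2, h2'⟩ ⟨v3, h3, h3'⟩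
    obtain ⟨b1, hb1, hb1', hc1⟩ := aux_d3 hP h1 h1' hwz
    obtain ⟨b2, hb2, hb2', hc2⟩ := aux_d3 hP h2 h2' hwu
    obtain ⟨b3, hb3, hb3', hc3⟩ := aux_d3 hP h3 h3' hzu
    refine ih b1 hb1.1 b2 b3 ?_ ?_ ?_ ⟨w, hb1, hb2⟩ ⟨z, hb1', hb3⟩ ⟨u, hb2', hb3'⟩
    · rintro rfl
      rcases hc1 u hb2' with h | h
      · exact hwu h.symm
      · exact hzu h.symm
    · rintro rfl
      rcases hc1 u hb3' with h | h
      · exact hwu h.symm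
      · exact hzu h.symm
    · rintro rfl
      rcases hc2 z hb3 with h | h
      · exact hwz h.symm
      · exact hzu h

theorem aux_top {Q : Type*} [PartialOrder Q] [Finite Q] {k : ℕ} {a b w z : Q}
    (h : IsDkIntervalWith k a b w z) :
    ∃ t, a ≤ t ∧ t ⋖ w ∧ t ⋖ z ∧ ∀ x, a ≤ x → x ≤ w → x ≤ z → x ≤ t := by
  obtain ⟨hab, ⟨hk, hw, hz, hwz, hzw, hall, hc1, hc2, hn1⟩, hn2⟩ := h
  have hne : {x ∈ Set.Icc a b | x ≤ w ∧ x ≤ z}.Nonempty := by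
    apply Set.nonempty_of_ncard_ne_zero; omega
  obtain ⟨t, ht⟩ := (Set.toFinite {x ∈ Set.Icc a b | x ≤ w ∧ x ≤ z}).exists_maximal hne
  have htm := ht.1
  have hmax : ∀ x, a ≤ x → x ≤ w → x ≤ z → x ≤ t := by
    intro x h1 h2 h3
    have hx : x ∈ {x ∈ Set.Icc a b | x ≤ w ∧ x ≤ z} := ⟨⟨h1, h2.trans hw.2⟩, h2, h3⟩
    rcases hc1.total hx htm with h | h
    · exact h
    · exact ht.2 hx h
  have htw : t < w := lt_of_le_of_ne htm.2.1 (fun h => hwz (h ▸ htm.2.2))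
  have htz : t < z := lt_of_le_of_ne htm.2.2 (fun h => hzw (h ▸ htm.2.1))
  refine ⟨t, htm.1.1, ⟨htw, ?_⟩, ⟨htz, ?_⟩, hmax⟩
  · intro c h1 h2
    rcases hall c ⟨htm.1.1.trans h1.le, h2.le.trans hw.2⟩ with rfl | rfl | h | h
    · exact lt_irrefl _ h2
    · exact hzw h2.le
    · exact lt_irrefl _ (h1.trans_le (hmax c (htm.1.1.trans h1.le) h.1 h.2))
    · exact lt_irrefl _ (h2.trans_le h.1)
  · intro c h1 h2
    rcases hall c ⟨htm.1.1.trans h1.le, h2.le.trans hz.2⟩ with rfl | rfl | h | h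
    · exact hwz h2.le
    · exact lt_irrefl _ h2
    · exact lt_irrefl _ (h1.trans_le (hmax c (htm.1.1.trans h1.le) h.1 h.2))
    · exact lt_irrefl _ (h2.trans_le h.2)

/-- Elements with two distinct covers. -/
def AuxBr {Q : Type*} [PartialOrder Q] (u : Q) : Prop := ∃ w z, w ≠ z ∧ u ⋖ w ∧ u ⋖ z

theorem aux_exists_cover {Q : Type*} [PartialOrder Q] [Finite Q] {a b : Q} (h : a < b) :
    ∃ c, a ⋖ c ∧ c ≤ b := by
  obtain ⟨c, hc⟩ := (Set.toFinite {x | a < x ∧ x ≤ b}).exists_minimal ⟨b, h, le_rfl⟩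
  refine ⟨c, ⟨hc.1.1, ?_⟩, hc.1.2⟩
  intro d h1 h2
  exact lt_irrefl _ (h2.trans_le (hc.2 ⟨h1, h2.le.trans hc.1.2⟩ h2.le))

/-- no tail element has a cover outside of the interval -/
theorem aux_tail {Q : Type*} [PartialOrder Q] [Finite Q] (hP : IsDComplete Q)
    {k : ℕ} {a b w z t : Q} (h : IsDkIntervalWith k a b w z)
    (htw : t ⋖ w) (htz : t ⋖ z) (v : Q) :
    a ≤ v → v ≤ t → ∀ c, v ⋖ c → c ≤ b := by
  obtain ⟨hab, ⟨hk, hw, hz, hwz, hzw, hall, hc1, hc2, hn1⟩, hn2⟩ := h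
  induction v using WellFoundedGT.induction with
  | ind v ih =>
    intro hav hvt c hc
    by_contra hcb
    rcases hvt.lt_or_eq with hlt | rfl
    · obtain ⟨v1, hv1, hv1t⟩ := aux_exists_cover hlt
      have hne : v1 ≠ c := by
        rintro rfl
        exact hcb (hv1t.trans (htw.1.le.trans hw.2))
      obtain ⟨q, hq1, hq2, -⟩ := aux_d3 hP hv1 hc hne
      exact hcb (hq2.1.le.trans (ih v1 hv1.1 (hav.trans hv1.1.le) hv1t q hq1))
    · refine aux_pattern hP w z c ?_ ?_ ?_ ⟨v, htw, htz⟩ ⟨v, htw, hc⟩ ⟨v, htz, hc⟩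
      · rintro rfl; exact hwz le_rfl
      · rintro rfl; exact hcb hw.2
      · rintro rfl; exact hcb hz.2

theorem aux_br {Q : Type*} [PartialOrder Q] [Finite Q] (hP : IsDComplete Q)
    {k : ℕ} {a b w z t : Q} (h : IsDkIntervalWith k a b w z)
    (htw : t ⋖ w) (htz : t ⋖ z) (hmax : ∀ x, a ≤ x → x ≤ w → x ≤ z → x ≤ t) (v : Q) :
    a ≤ v → v ≤ t → ∀ u, AuxBr u → v ≤ u → t ≤ u := by
  have htail := aux_tail hP h htw htz
  obtain ⟨hab, ⟨hk, hw, hz, hwz, hzw, hall, hc1, hc2, hn1⟩, hn2⟩ := h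
  induction v using WellFoundedGT.induction with
  | ind v ih =>
    intro hav hvt u hu hvu
    rcases hvt.lt_or_eq with hlt | rfl
    · obtain ⟨v1, hv1, hv1t⟩ := aux_exists_cover hlt
      have huniq : ∀ c, v ⋖ c → c = v1 := by
        intro c hc
        have hcb := htail v hav hvt c hc
        have hac : a ≤ c := hav.trans hc.1.le
        have hct : c = v1 ∨ v1 ≤ c ∨ c ≤ v1 := by
          rcases hall c ⟨hac, hcb⟩ with rfl | rfl | h | h
          · exact Or.inr (Or.inl (hv1t.trans htw.1.le))
          · exact Or.inr (Or.inl (hv1t.trans htz.1.le))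
          · have hm1 : v1 ∈ {x ∈ Set.Icc a b | x ≤ w ∧ x ≤ z} :=
              ⟨⟨hav.trans hv1.1.le, hv1t.trans (htw.1.le.trans hw.2)⟩,
                hv1t.trans htw.1.le, hv1t.trans htz.1.le⟩
            exact Or.inr (hc1.total hm1 ⟨⟨hac, hcb⟩, h⟩)
          · exact Or.inr (Or.inl (hv1t.trans (htw.1.le.trans h.1)))
        rcases hct with h | h | h
        · exact h
        · by_contra hne
          exact hc.2 hv1.1 (lt_of_le_of_ne h (Ne.symm hne))
        · by_contra hne
          exact hv1.2 hc.1 (lt_of_le_of_ne h hne)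
      rcases hvu.lt_or_eq with hlt' | rfl
      · obtain ⟨c, hc, hcu⟩ := aux_exists_cover hlt'
        obtain rfl := huniq c hc
        exact ih c hv1.1 (hav.trans hv1.1.le) hv1t u hu hcu
      · obtain ⟨c, c', hne, h1, h2⟩ := hu
        exact absurd ((huniq c h1).trans (huniq c' h2).symm) hne
    · exact hvu

theorem aux_pick {Q : Type*} [PartialOrder Q] [Finite Q] (n : ℕ) : ∀ (C : Set Q),
    IsChain (· ≤ ·) C → C.ncard = n → ∀ m, 1 ≤ m → m ≤ n →
      ∃ a ∈ C, {x ∈ C | a ≤ x}.ncard = m := by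
  induction n with
  | zero => intro C _ _ m h1 h2; omega
  | succ n ih =>
    intro C hC hn m h1 h2
    have hne : C.Nonempty := by
      apply Set.nonempty_of_ncard_ne_zero; omega
    obtain ⟨a, ha⟩ := (Set.toFinite C).exists_minimal hne
    have hmin : ∀ x ∈ C, a ≤ x := by
      intro x hx
      rcases hC.total ha.1 hx with h | h
      · exact h
      · exact ha.2 hx h
    by_cases hm : m = n + 1
    · refine ⟨a, ha.1, ?_⟩
      have : {x ∈ C | a ≤ x} = C := by
        ext x; exact ⟨fun h => h.1, fun h => ⟨h, hmin x h⟩⟩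
      rw [this, hn, hm]
    · have hcard : (C \ {a}).ncard = n := by
        rw [Set.ncard_sdiff_singleton_of_mem ha.1]; omega
      obtain ⟨c, hc, hcn⟩ := ih (C \ {a}) (hC.mono Set.sdiff_subset) hcard m h1 (by omega)
      refine ⟨c, hc.1, ?_⟩
      rw [← hcn]
      congr 1
      ext x
      constructor
      · rintro ⟨hx, hcx⟩
        refine ⟨⟨hx, ?_⟩, hcx⟩
        rintro rfl
        exact hc.2 (le_antisymm hcx (hmin c hc.1))
      · rintro ⟨hx, hcx⟩
        exact ⟨hx.1, hcx⟩

theorem aux_nested {Q : Type*} [PartialOrder Q] [Finite Q] {k : ℕ} {a b w z p : Q}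
    (h : IsDkIntervalWith k a b w z) (hp : p ∈ Set.Icc a b) (hwp : w ≤ p) (hzp : z ≤ p) :
    ∃ c, a ≤ c ∧ ∃ m, IsDkIntervalWith m c p w z := by
  obtain ⟨hab, ⟨hk, hw, hz, hwz, hzw, hall, hc1, hc2, hn1⟩, hn2⟩ := h
  set N : Set Q := {x ∈ Set.Icc a p | w ≤ x ∧ z ≤ x} with hN
  have hsub : N ⊆ {x ∈ Set.Icc a b | w ≤ x ∧ z ≤ x} := by
    rintro x ⟨hx, hx'⟩
    exact ⟨⟨hx.1, hx.2.trans hp.2⟩, hx'⟩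
  have hle : N.ncard ≤ k - 2 := hn2 ▸ Set.ncard_le_ncard hsub (Set.toFinite _)
  have hpos : 1 ≤ N.ncard :=
    (Set.ncard_pos (Set.toFinite _)).2 ⟨p, ⟨⟨hp.1, le_rfl⟩, hwp, hzp⟩⟩
  obtain ⟨c, hc, hcn⟩ := aux_pick _ _ hc1 hn1 N.ncard hpos hle
  have hac := hc.1.1
  have hIcc : Set.Icc c p ⊆ Set.Icc a b := Set.Icc_subset_Icc hac hp.2
  refine ⟨c, hac, N.ncard + 2, hc.2.1.trans hwp,
    ⟨by omega, ⟨hc.2.1, hwp⟩, ⟨hc.2.2, hzp⟩, hwz, hzw, fun x hx => hall x (hIcc hx),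
      hc1.mono ?_, hc2.mono ?_, ?_⟩, ?_⟩
  · rintro x ⟨hx, hx'⟩; exact ⟨hIcc hx, hx'⟩
  · rintro x ⟨hx, hx'⟩; exact ⟨hIcc hx, hx'⟩
  · rw [Nat.add_sub_cancel, ← hcn]
    congr 1
    ext x
    constructor
    · rintro ⟨hx, hx'⟩; exact ⟨⟨hIcc hx, hx'⟩, hx.1⟩
    · rintro ⟨⟨hx, hx'⟩, hcx⟩; exact ⟨⟨hcx, hx'.1.trans hwp⟩, hx'⟩
  · rw [Nat.add_sub_cancel]
    congr 1
    ext x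
    constructor
    · rintro ⟨hx, hx'⟩; exact ⟨⟨hac.trans hx.1, hx.2⟩, hx'⟩
    · rintro ⟨hx, hx'⟩; exact ⟨⟨hc.2.1.trans hx'.1, hx.2⟩, hx'⟩

/-- number of branch elements above `x` -/
noncomputable def auxKey {Q : Type*} [PartialOrder Q] (x : Q) : ℕ :=
  {u : Q | AuxBr u ∧ x ≤ u}.ncard

theorem auxKey_anti {Q : Type*} [PartialOrder Q] [Finite Q] {x y : Q} (h : x ≤ y) :
    auxKey y ≤ auxKey x :=
  Set.ncard_le_ncard (fun _ hu => ⟨hu.1, h.trans hu.2⟩) (Set.toFinite _)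

theorem aux_main_s14 {Q : Type*} [PartialOrder Q] [Finite Q] (hP : IsDComplete Q)
    {k : ℕ} {x b w z p a' b' : Q} (h : IsDkIntervalWith k x b w z) (hpw : p = w ∨ p = z)
    (hN : IsNeckOf p a' b') : auxKey x < auxKey a' := by
  obtain ⟨t, hxt, htw, htz, hmax⟩ := aux_top h
  have htp : t ⋖ p := by rcases hpw with rfl | rfl <;> assumption
  obtain ⟨k', w', z', hI, hp, hwp, hzp⟩ := hN
  obtain ⟨c, hac, m, hc⟩ := aux_nested hI hp hwp hzp
  obtain ⟨t', hct', htw', htz', -⟩ := aux_top hc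
  have htm : t ∈ Set.Icc c p := hP.2.1 c p ⟨m, w', z', hc⟩ t htp
  obtain ⟨hab, ⟨hk, hw, hz, hwz, hzw, hall, hc1, hc2, hn1⟩, hn2⟩ := hc
  have hlt : t' < t := by
    rcases hall t htm with rfl | rfl | ⟨h1, h2⟩ | ⟨h1, h2⟩
    · exact htw'.1
    · exact htz'.1
    · exfalso
      rcases htp.eq_or_eq h1 hwp with e | e
      · exact hwz (e ▸ h2)
      · exact hzw (e ▸ hzp)
    · exact htw'.1.trans_le h1
  apply Set.ncard_lt_ncard _ (Set.toFinite _)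
  have hbr : AuxBr t' := ⟨w', z', fun e => hwz e.le, htw', htz'⟩
  refine ⟨?_, ?_⟩
  · rintro u ⟨hu, hxu⟩
    exact ⟨hu, (hac.trans (hct'.trans hlt.le)).trans
      (aux_br hP h htw htz hmax x le_rfl hxt u hu hxu)⟩
  · intro hss
    have := hss (show t' ∈ {u : Q | AuxBr u ∧ a' ≤ u} from ⟨hbr, hac.trans hct'⟩)
    exact lt_irrefl _ (hlt.trans_le (aux_br hP h htw htz hmax x le_rfl hxt t' hbr this.2))

theorem aux_order {Q : Type*} [PartialOrder Q] [Fintype Q] (f : Q → ℕ)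
    (hf : ∀ x y : Q, x ≤ y → f y ≤ f x) :
    ∃ e : Fin (Fintype.card Q) ≃ Q, IsLinExt e ∧ ∀ i j, f (e i) < f (e j) → i < j := by
  classical
  let g : Q → ℕ ×ₗ (LinearExtension Q)ᵒᵈ :=
    fun x => toLex (f x, OrderDual.toDual (toLinearExtension x))
  have hg : Function.Injective g := by
    intro x y hxy
    exact congrArg (fun p => OrderDual.ofDual (ofLex p).2) hxy
  have hcard : (Finset.univ.image g).card = Fintype.card Q := by
    rw [Finset.card_image_of_injective _ hg, Finset.card_univ]
  let o := (Finset.univ.image g).orderIsoOfFin hcard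
  let r : Q ≃ (Finset.univ.image g : Finset _) :=
    Equiv.ofBijective (fun x => ⟨g x, by simp⟩) (by
      constructor
      · intro x y hxy
        exact hg (congrArg Subtype.val hxy)
      · rintro ⟨y, hy⟩
        obtain ⟨x, -, rfl⟩ := Finset.mem_image.1 hy
        exact ⟨x, rfl⟩)
  have key : ∀ i j, g (r.symm (o i)) < g (r.symm (o j)) → i < j := by
    intro i j h
    have h1 : ∀ i, g (r.symm (o i)) = (o i).1 := fun i =>
      congrArg Subtype.val (r.apply_symm_apply (o i))
    rw [h1, h1] at h
    exact o.lt_iff_lt.1 h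
  refine ⟨o.toEquiv.trans r.symm, ?_, ?_⟩
  · intro i j hij
    apply key
    change r.symm (o i) < r.symm (o j) at hij
    rw [Prod.Lex.lt_iff]
    rcases (hf _ _ hij.le).lt_or_eq with h | h
    · exact Or.inl h
    · refine Or.inr ⟨h, ?_⟩
      have h2 : (toLinearExtension (r.symm (o i)) : LinearExtension Q) <
          toLinearExtension (r.symm (o j)) :=
        lt_of_le_of_ne (toLinearExtension.monotone hij.le) (fun e => hij.ne e)
      exact OrderDual.toDual_lt_toDual.2 h2
  · intro i j hij
    apply key
    rw [Prod.Lex.lt_iff]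
    exact Or.inl hij

end Helpers

/-- Every d-complete poset has a stable insertion order: a linear extension such
that whenever `e i` is the bottom of a `d`-interval with side elements `w, z`,
neither `w` nor `z` is a neck element of any `d`-interval contained in
`{e 0, …, e i}`. -/
theorem exists_stable_insertion_order {P : Type*} [PartialOrder P] [Fintype P]
    (hP : IsDComplete P) :
    ∃ e : Fin (Fintype.card P) ≃ P, IsLinExt e ∧
      ∀ (i : Fin (Fintype.card P)) (b w z : P), IsDIntervalWith (e i) b w z →
        ∀ a' b' : P, IsDInterval a' b' →
          Set.Icc a' b' ⊆ {x : P | ∃ j, j ≤ i ∧ e j = x} →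
          ¬ IsNeckOf w a' b' ∧ ¬ IsNeckOf z a' b' := by 
  obtain ⟨e, he, hkey⟩ := aux_order (auxKey : P → ℕ) (fun x y h => auxKey_anti h)
  refine ⟨e, he, ?_⟩
  rintro i b w z ⟨k, hI⟩ a' b' ⟨k', w', z', hI'⟩ hsub
  obtain ⟨j, hji, hj⟩ := hsub ⟨le_rfl, hI'.1⟩
  have main : ∀ p, (p = w ∨ p = z) → ¬ IsNeckOf p a' b' := by
    intro p hp hN
    have hlt := aux_main_s14 hP hI hp hN
    rw [← hj] at hlt
    exact absurd (hkey i j hlt) (not_lt.2 hji)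
  exact ⟨main w (Or.inl rfl), main z (Or.inr rfl)⟩
end
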